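/- arXiv:2511.05077 — 6 statements merged into one kernel-verified Lean document; each statement's English description precedes it below -/
import Mathlib

section
/- There exist universal constants c, C > 0 such that for all k ≥ 2 and all n ≥ C log k: for every estimator f̂, i.e. every measurable map from ℕ^k (the observed counts (N_1,…,N_k)) to pmfs on ℕ, we have sup_{P ∈ Δ_{k−1}} E[ H²(f̂(N_1,…,N_k), f_{π_P}) ] ≥ c/k, where the expectation is over independent N_i ~ Poisson(n p_i). -/
open MeasureTheory ProbabilityTheory Set

noncomputable section

/-- Poisson pmf `poi j λ = λ^j e^{-λ}/j!`. -/
def poi (j : ℕ) (lam : ℝ) : ℝ := lam ^ j * Real.exp (-lam) / (Nat.factorial j)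

/-- Poisson mixture pmf `f_π(j) = ∫_{[0,1]} poi(j, n r) dπ(r)`. -/
def pmix (n : ℝ) (π : Measure ℝ) (j : ℕ) : ℝ := ∫ r in Set.Icc (0:ℝ) 1, poi j (n * r) ∂π

/-- Poisson mixture directly in the mean parameter. -/
def pmixT (P : Measure ℝ) (j : ℕ) : ℝ := ∫ θ, poi j θ ∂P

/-- Borel probability measure concentrated on a set `I`. -/
def IsProbOn (π : Measure ℝ) (I : Set ℝ) : Prop := IsProbabilityMeasure π ∧ π Iᶜ = 0

/-- Poisson distribution as a measure on ℕ. -/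
def poissonMeasure (lam : ℝ) : Measure ℕ :=
  Measure.sum (fun j => (ENNReal.ofReal (poi j lam)) • Measure.dirac j)

/-- The NPMLE property: `π` maximizes `Σ_i log f_π(N_i)` over probability measures on `[0,1]`. -/
def IsNPMLE (n : ℝ) {k : ℕ} (N : Fin k → ℕ) (π : Measure ℝ) : Prop :=
  IsProbOn π (Set.Icc 0 1) ∧
  ∀ Q : Measure ℝ, IsProbOn Q (Set.Icc 0 1) →
    ∑ i, Real.log (pmix n Q (N i)) ≤ ∑ i, Real.log (pmix n π (N i))

/-- The histogram distribution `π_P = (1/k) Σ_i δ_{p_i}`. -/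
def histMeasure {k : ℕ} (p : Fin k → ℝ) : Measure ℝ :=
  ((k : ENNReal))⁻¹ • ∑ i, Measure.dirac (p i)

/-- Squared Hellinger distance between pmfs on ℕ. -/
def hellingerSq (f g : ℕ → ℝ) : ℝ := ∑' j, (Real.sqrt (f j) - Real.sqrt (g j)) ^ 2

/-- Hellinger distance between pmfs on ℕ. -/
def hellinger (f g : ℕ → ℝ) : ℝ := Real.sqrt (hellingerSq f g)

/-- 1-Wasserstein distance between measures on ℝ. -/
def W1 (μ ν : Measure ℝ) : ℝ :=
  sInf {c : ℝ | ∃ γ : Measure (ℝ × ℝ), IsProbabilityMeasure γ ∧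
    γ.map Prod.fst = μ ∧ γ.map Prod.snd = ν ∧ c = ∫ q, |q.1 - q.2| ∂γ}

/-- `r`-fattening of a set: `S_r = ∪_{x∈S} [x - r(x), x + r(x)]`. -/
def fatten (r : ℝ → ℝ) (S : Set ℝ) : Set ℝ := ⋃ x ∈ S, Set.Icc (x - r x) (x + r x)

/-- `r` is `t`-large: `r(x) ≥ t` and `r(x) ≥ √(t x)` on `[0,1]`
(i.e. `inf_x min(r(x)²/x, r(x)) ≥ t`). -/
def TLarge (t : ℝ) (r : ℝ → ℝ) : Prop :=
  ∀ x ∈ Set.Icc (0:ℝ) 1, t ≤ r x ∧ Real.sqrt (t * x) ≤ r x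

/-- `r`-complement of `S`: union of all `S' ⊆ [0,1]` that are `r`-separated from `S`. -/
def rcomp (r : ℝ → ℝ) (S : Set ℝ) : Set ℝ :=
  ⋃₀ {S' : Set ℝ | S' ⊆ Set.Icc 0 1 ∧ fatten r S ∩ fatten r S' = ∅}

/-- `r*_t(x) = √(t x) + t`. -/
def rstar (t x : ℝ) : ℝ := Real.sqrt (t * x) + t

/-- Integral probability metric with respect to a function class `F`. -/
def dIPM (F : Set (ℝ → ℝ)) (μ ν : Measure ℝ) : ℝ :=
  ⨆ g : F, |(∫ x, g.1 x ∂μ) - ∫ x, g.1 x ∂ν|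

/-- Maximum deviation `M(f,I) = sup_{x,y ∈ I} |f x - f y|`. -/
def Mdev (f : ℝ → ℝ) (I : Set ℝ) : ℝ :=
  sSup ((fun q : ℝ × ℝ => |f q.1 - f q.2|) '' (I ×ˢ I))

/-- Best uniform polynomial approximation error of degree ≤ D on `I`. -/
def polyErr (D : ℕ) (f : ℝ → ℝ) (I : Set ℝ) : ℝ :=
  sInf {c : ℝ | ∃ q : Polynomial ℝ, q.natDegree ≤ D ∧
    c = sSup ((fun x => |f x - Polynomial.eval x q|) '' I)}

/-- The function class `F_{s,γ,η}`. -/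
def Fclass (s : ℕ) (γ : ℝ) (η : ℕ → ℝ) : Set (ℝ → ℝ) :=
  {f | ∃ ℓ : ℝ → ℝ, ContDiffOn ℝ (s : ℕ∞) ℓ (Set.Ioi 0) ∧ (∀ x, f x = x * ℓ x) ∧
    ∀ r ≤ s, ∀ x ∈ Set.Ioc (0:ℝ) 1,
      |x ^ r * iteratedDeriv r ℓ x| ≤
        (Nat.factorial s : ℝ) * x ^ (γ - 1) * Real.log (1 + 1 / x) ^ (η r)}

/-- `log_+(x) = max(1, log x)`. -/
def logPlus (x : ℝ) : ℝ := max 1 (Real.log x)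

/-- Separation assumption with explicit centers `q_1,…,q_L`. -/
def SepCenters {k L : ℕ} (p : Fin k → ℝ) (q : Fin L → ℝ) (s t : ℝ) : Prop :=
  Function.Injective q ∧ (∀ ℓ, q ℓ ∈ Set.Icc (0:ℝ) 1) ∧
  (∀ i j, i ≠ j → fatten (rstar t) {q i} ∩ fatten (rstar t) {q j} = ∅) ∧
  ∀ i, p i ∈ ⋃ ℓ, fatten (rstar s) {q ℓ}

/-- The separation assumption (Assumption 1) with `L` clusters and parameters `s < t`. -/
def SepAssumption {k : ℕ} (p : Fin k → ℝ) (L : ℕ) (s t : ℝ) : Prop :=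
  ∃ q : Fin L → ℝ, SepCenters p q s t

end

theorem poi_nonneg (j : ℕ) {lam : ℝ} (h : 0 ≤ lam) : 0 ≤ poi j lam := by
  unfold poi; positivity

theorem hasSum_poi (lam : ℝ) : HasSum (fun j => poi j lam) 1 := by
  have h := (NormedSpace.expSeries_div_hasSum_exp lam).mul_right (Real.exp (-lam))
  rw [← Real.exp_eq_exp_ℝ, ← Real.exp_add, add_neg_cancel, Real.exp_zero] at h
  refine h.congr_fun ?_
  intro j
  unfold poi
  ring

theorem poissonMeasure_apply_singleton (lam : ℝ) (j : ℕ) :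
    _root_.poissonMeasure lam {j} = ENNReal.ofReal (poi j lam) := by
  rw [_root_.poissonMeasure, Measure.sum_smul_dirac_singleton]

theorem isProbabilityMeasure_poissonMeasure {lam : ℝ} (h : 0 ≤ lam) :
    IsProbabilityMeasure (_root_.poissonMeasure lam) := by
  refine ⟨?_⟩
  rw [_root_.poissonMeasure, Measure.sum_apply _ MeasurableSet.univ]
  simp only [Measure.smul_apply, measure_univ, smul_eq_mul, mul_one]
  rw [← ENNReal.ofReal_tsum_of_nonneg (fun j => poi_nonneg j h) (hasSum_poi lam).summable,
    (hasSum_poi lam).tsum_eq, ENNReal.ofReal_one]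

theorem exp_neg_one_mul_poi_le (j : ℕ) {lam : ℝ} (h : 0 ≤ lam) :
    Real.exp (-1) * poi j lam ≤ poi j (lam + 1) := by
  unfold poi
  rw [neg_add, Real.exp_add, ← mul_div_assoc]
  have h1 : lam ^ j ≤ (lam + 1) ^ j := by gcongr; linarith
  refine div_le_div_of_nonneg_right ?_ (by positivity)
  calc Real.exp (-1) * (lam ^ j * Real.exp (-lam))
      = lam ^ j * (Real.exp (-lam) * Real.exp (-1)) := by ring
    _ ≤ _ := by gcongr

/-- On a countable product, a coordinatewise lower bound on atoms gives a lower bound on the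
product measures. -/
theorem prod_smul_pi_le_pi {ι : Type*} [Fintype ι] (w : ι → ENNReal) (μ ν : ι → Measure ℕ)
    [∀ i, SigmaFinite (μ i)] [∀ i, SigmaFinite (ν i)]
    (h : ∀ i m, w i * ν i {m} ≤ μ i {m}) :
    (∏ i, w i) • Measure.pi ν ≤ Measure.pi μ := by
  classical
  refine Measure.le_iff.2 fun s hs => ?_
  rw [← Measure.tsum_indicator_apply_singleton _ s hs,
    ← Measure.tsum_indicator_apply_singleton _ s hs]
  refine ENNReal.tsum_le_tsum fun x => Set.indicator_le_indicator ?_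
  rw [Measure.smul_apply, Measure.pi_singleton, Measure.pi_singleton, smul_eq_mul,
    ← Finset.prod_mul_distrib]
  exact Finset.prod_le_prod' fun i _ => h i (x i)

/-- Raising one Poisson mean by `1` costs at most a factor `e⁻¹` in likelihood. -/
theorem smul_pi_poissonMeasure_le {k : ℕ} (lam : Fin k → ℝ) (h : ∀ i, 0 ≤ lam i) (a : Fin k) :
    ENNReal.ofReal (Real.exp (-1)) • Measure.pi (fun i => _root_.poissonMeasure (lam i)) ≤
      Measure.pi (fun i => _root_.poissonMeasure (lam i + if i = a then 1 else 0)) := by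
  have h1 : ∀ i, IsProbabilityMeasure (_root_.poissonMeasure (lam i)) :=
    fun i => isProbabilityMeasure_poissonMeasure (h i)
  have h2 : ∀ i, IsProbabilityMeasure
      (_root_.poissonMeasure (lam i + if i = a then 1 else 0)) :=
    fun i => isProbabilityMeasure_poissonMeasure (by have := h i; split_ifs <;> linarith)
  have key := prod_smul_pi_le_pi
    (fun i => if i = a then ENNReal.ofReal (Real.exp (-1)) else 1)
    (fun i => _root_.poissonMeasure (lam i + if i = a then 1 else 0))
    (fun i => _root_.poissonMeasure (lam i)) (fun i m => ?_)
  · simpa using key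
  · simp only [poissonMeasure_apply_singleton]
    split_ifs
    · rw [← ENNReal.ofReal_mul (Real.exp_pos _).le]
      exact ENNReal.ofReal_le_ofReal (exp_neg_one_mul_poi_le m (h i))
    · simp

theorem pmix_histMeasure (n : ℝ) {k : ℕ} (p : Fin k → ℝ) (hp : ∀ i, p i ∈ Set.Icc (0 : ℝ) 1)
    (j : ℕ) : pmix n (histMeasure p) j = (k : ℝ)⁻¹ * ∑ i, poi j (n * p i) := by
  rw [pmix, ← integral_indicator measurableSet_Icc, histMeasure, integral_smul_measure,
    integral_finsetSum_measure (fun i _ => integrable_dirac (by finiteness))]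
  simp [integral_dirac, Set.indicator_of_mem (hp _)]

theorem sq_sqrt_sub_sqrt_le {a b : ℝ} (ha : 0 ≤ a) (hb : 0 ≤ b) :
    (Real.sqrt a - Real.sqrt b) ^ 2 ≤ a + b := by
  nlinarith [Real.sq_sqrt ha, Real.sq_sqrt hb, Real.sqrt_nonneg a, Real.sqrt_nonneg b,
    mul_nonneg (Real.sqrt_nonneg a) (Real.sqrt_nonneg b)]

theorem summable_hellingerSq {f g : ℕ → ℝ} (hf : ∀ j, 0 ≤ f j) (hg : ∀ j, 0 ≤ g j)
    (hfs : HasSum f 1) (hgs : HasSum g 1) :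
    Summable fun j => (Real.sqrt (f j) - Real.sqrt (g j)) ^ 2 :=
  Summable.of_nonneg_of_le (fun _ => sq_nonneg _) (fun j => sq_sqrt_sub_sqrt_le (hf j) (hg j))
    (hfs.add hgs).summable

theorem hellingerSq_nonneg (f g : ℕ → ℝ) : 0 ≤ hellingerSq f g :=
  tsum_nonneg fun _ => sq_nonneg _

theorem hellingerSq_le_two {f g : ℕ → ℝ} (hf : ∀ j, 0 ≤ f j) (hg : ∀ j, 0 ≤ g j)
    (hfs : HasSum f 1) (hgs : HasSum g 1) : hellingerSq f g ≤ 2 := by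
  have h := (summable_hellingerSq hf hg hfs hgs).tsum_le_tsum
    (fun j => sq_sqrt_sub_sqrt_le (hf j) (hg j)) (hfs.add hgs).summable
  rw [(hfs.add hgs).tsum_eq] at h
  unfold hellingerSq
  linarith

theorem pmix_histMeasure_nonneg {n : ℝ} (hn : 0 ≤ n) {k : ℕ} (p : Fin k → ℝ)
    (hp : ∀ i, p i ∈ Set.Icc (0 : ℝ) 1) (j : ℕ) : 0 ≤ pmix n (histMeasure p) j := by
  rw [pmix_histMeasure n p hp]
  exact mul_nonneg (by positivity)
    (Finset.sum_nonneg fun i _ => poi_nonneg j (mul_nonneg hn (hp i).1))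

theorem hasSum_pmix_histMeasure (n : ℝ) {k : ℕ} (hk : k ≠ 0) (p : Fin k → ℝ)
    (hp : ∀ i, p i ∈ Set.Icc (0 : ℝ) 1) : HasSum (pmix n (histMeasure p)) 1 := by
  have h := (hasSum_sum (s := Finset.univ)
    fun (i : Fin k) _ => hasSum_poi (n * p i)).mul_left (k : ℝ)⁻¹
  have hk' : (k : ℝ) ≠ 0 := by exact_mod_cast hk
  simp only [Finset.sum_const, Finset.card_univ, Fintype.card_fin, nsmul_eq_mul, mul_one,
    inv_mul_cancel₀ hk'] at h
  exact h.congr_fun fun j => pmix_histMeasure n p hp j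

/-- Le Cam's two-point bound for bounded losses whose laws share a common component. -/
theorem le_integral_add_integral {α : Type*} [MeasurableSpace α] [DiscreteMeasurableSpace α]
    (ν μ₀ μ₁ : Measure α) [IsProbabilityMeasure ν] [IsFiniteMeasure μ₀] [IsFiniteMeasure μ₁]
    {w B d : ℝ} (hw : 0 ≤ w) (h₀ : ENNReal.ofReal w • ν ≤ μ₀) (h₁ : ENNReal.ofReal w • ν ≤ μ₁)
    (F G : α → ℝ) (hF : ∀ x, 0 ≤ F x) (hG : ∀ x, 0 ≤ G x) (hFB : ∀ x, F x ≤ B)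
    (hGB : ∀ x, G x ≤ B) (hd : ∀ x, d ≤ F x + G x) :
    w * d ≤ (∫ x, F x ∂μ₀) + ∫ x, G x ∂μ₁ := by
  have hint : ∀ (μ : Measure α) [IsFiniteMeasure μ] (H : α → ℝ), (∀ x, 0 ≤ H x) →
      (∀ x, H x ≤ B) → Integrable H μ := fun μ _ H h0 hB =>
    Integrable.of_bound (Measurable.of_discrete.aestronglyMeasurable) B
      (Filter.Eventually.of_forall fun x => by rw [Real.norm_of_nonneg (h0 x)]; exact hB x)
  have hsub : ∀ (μ : Measure α) [IsFiniteMeasure μ] (H : α → ℝ), ENNReal.ofReal w • ν ≤ μ →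
      (∀ x, 0 ≤ H x) → (∀ x, H x ≤ B) → w * ∫ x, H x ∂ν ≤ ∫ x, H x ∂μ := by
    intro μ _ H hle h0 hB
    have := integral_mono_measure hle (Filter.Eventually.of_forall h0) (hint μ H h0 hB)
    rwa [integral_smul_measure, ENNReal.toReal_ofReal hw, smul_eq_mul] at this
  have hsum : d ≤ (∫ x, F x ∂ν) + ∫ x, G x ∂ν := by
    rw [← integral_add (hint ν F hF hFB) (hint ν G hG hGB)]
    have := integral_mono (integrable_const d)
      ((hint ν F hF hFB).add (hint ν G hG hGB)) hd
    simpa using this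
  calc w * d ≤ w * ((∫ x, F x ∂ν) + ∫ x, G x ∂ν) := by gcongr
    _ ≤ _ := by
      rw [mul_add]
      exact add_le_add (hsub μ₀ F h₀ hF hFB) (hsub μ₁ G h₁ hG hGB)

/-- One coordinate separates two pmfs in the sense needed for the two-point bound. -/
theorem le_hellingerSq_add_hellingerSq {f g₀ g₁ : ℕ → ℝ} (hf : ∀ j, 0 ≤ f j)
    (hg₀ : ∀ j, 0 ≤ g₀ j) (hg₁ : ∀ j, 0 ≤ g₁ j) (hfs : HasSum f 1) (hgs₀ : HasSum g₀ 1)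
    (hgs₁ : HasSum g₁ 1) (j : ℕ) {a : ℝ} (ha : 4 * g₀ j ≤ a) (hb : a ≤ g₁ j) :
    a / 8 ≤ hellingerSq f g₀ + hellingerSq f g₁ := by
  have e₀ := (summable_hellingerSq hf hg₀ hfs hgs₀).le_tsum j fun _ _ => sq_nonneg _
  have e₁ := (summable_hellingerSq hf hg₁ hfs hgs₁).le_tsum j fun _ _ => sq_nonneg _
  have ha0 : 0 ≤ a := by linarith [hg₀ j]
  have s₀ : 2 * Real.sqrt (g₀ j) ≤ Real.sqrt a := by
    apply Real.le_sqrt_of_sq_le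
    rw [mul_pow, Real.sq_sqrt (hg₀ j)]
    linarith
  have s₁ := Real.sqrt_le_sqrt hb
  have hsq := Real.sq_sqrt ha0
  have hd : Real.sqrt a / 2 ≤ Real.sqrt (g₁ j) - Real.sqrt (g₀ j) := by linarith
  have hd2 : (Real.sqrt a / 2) ^ 2 ≤ (Real.sqrt (g₁ j) - Real.sqrt (g₀ j)) ^ 2 :=
    pow_le_pow_left₀ (by positivity) hd 2
  unfold hellingerSq
  nlinarith [sq_nonneg (2 * Real.sqrt (f j) - Real.sqrt (g₀ j) - Real.sqrt (g₁ j))]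

theorem four_mul_mul_exp_neg_le {n : ℝ} (hn : 8 ≤ n) :
    4 * (n * Real.exp (-n)) ≤ Real.exp (-1) := by
  have h := Real.quadratic_le_exp_of_nonneg (x := n - 1) (by linarith)
  have h4 : 4 * n ≤ Real.exp (n - 1) := by nlinarith
  calc 4 * (n * Real.exp (-n)) = 4 * n * Real.exp (-n) := by ring
    _ ≤ Real.exp (n - 1) * Real.exp (-n) := by gcongr
    _ = Real.exp (-1) := by rw [← Real.exp_add]; ring_nf

/-- minimax lower bound for estimating the mixture density
(Proposition `pi_p_minimax_lb`). -/
theorem stmt4 :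
    ∃ c C : ℝ, 0 < c ∧ 0 < C ∧
    ∀ (k : ℕ), 2 ≤ k → ∀ (n : ℝ), C * Real.log k ≤ n →
    ∀ fhat : (Fin k → ℕ) → ℕ → ℝ,
      (∀ j, Measurable (fun N => fhat N j)) →
      (∀ N, (∀ j, 0 ≤ fhat N j) ∧ ∑' j, fhat N j = 1) →
      c / k ≤ ⨆ P : {q : Fin k → ℝ // (∀ i, 0 ≤ q i) ∧ ∑ i, q i = 1},
        ∫ N, hellingerSq (fhat N) (pmix n (histMeasure P.1))
          ∂(MeasureTheory.Measure.pi fun i => poissonMeasure (n * P.1 i)) := by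
  refine ⟨Real.exp (-1) * Real.exp (-1) / 16, 20, by positivity, by norm_num, ?_⟩
  intro k hk n hn fhat _ hfhat
  have hk0 : k ≠ 0 := by omega
  have hkR : (2 : ℝ) ≤ k := by exact_mod_cast hk
  have hn8 : 8 ≤ n := by
    have := Real.log_le_log (by norm_num) hkR
    linarith [Real.log_two_gt_d9]
  have hn0 : 0 < n := by linarith
  have hfs : ∀ N, HasSum (fhat N) 1 := fun N => by
    have hs : Summable (fhat N) := by
      by_contra h
      have := (hfhat N).2
      rw [tsum_eq_zero_of_not_summable h] at this
      norm_num at this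
    simpa only [(hfhat N).2] using hs.hasSum
  have hIcc : ∀ P : {q : Fin k → ℝ // (∀ i, 0 ≤ q i) ∧ ∑ i, q i = 1},
      ∀ i, P.1 i ∈ Set.Icc (0 : ℝ) 1 := fun P i =>
    ⟨P.2.1 i, (Finset.single_le_sum (fun j _ => P.2.1 j) (Finset.mem_univ i)).trans_eq P.2.2⟩
  have hprob : ∀ P : {q : Fin k → ℝ // (∀ i, 0 ≤ q i) ∧ ∑ i, q i = 1},
      ∀ i, IsProbabilityMeasure (_root_.poissonMeasure (n * P.1 i)) := fun P i =>
    isProbabilityMeasure_poissonMeasure (mul_nonneg hn0.le (P.2.1 i))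
  have hle2 : ∀ (P : {q : Fin k → ℝ // (∀ i, 0 ≤ q i) ∧ ∑ i, q i = 1}) (N : Fin k → ℕ),
      hellingerSq (fhat N) (pmix n (histMeasure P.1)) ≤ 2 := fun P N =>
    hellingerSq_le_two (hfhat N).1 (pmix_histMeasure_nonneg hn0.le _ (hIcc P)) (hfs N)
      (hasSum_pmix_histMeasure n hk0 _ (hIcc P))
  have hbdd : BddAbove (Set.range fun P : {q : Fin k → ℝ // (∀ i, 0 ≤ q i) ∧ ∑ i, q i = 1} =>
      ∫ N, hellingerSq (fhat N) (pmix n (histMeasure P.1))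
        ∂(MeasureTheory.Measure.pi fun i => _root_.poissonMeasure (n * P.1 i))) := by
    refine ⟨2, ?_⟩
    rintro _ ⟨P, rfl⟩
    have := hprob P
    have := integral_mono_of_nonneg
      (μ := MeasureTheory.Measure.pi fun i => _root_.poissonMeasure (n * P.1 i))
      (Filter.Eventually.of_forall fun N => hellingerSq_nonneg (fhat N)
        (pmix n (histMeasure P.1))) (integrable_const (2 : ℝ))
      (Filter.Eventually.of_forall (hle2 P))
    simpa using this
  let a : Fin k := ⟨0, by omega⟩
  let b : Fin k := ⟨1, by omega⟩
  have hba : b ≠ a := by simp [a, b]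
  let lam : Fin k → ℝ := fun i => if i = a then n - 1 else 0
  have hlam : ∀ i, 0 ≤ lam i := fun i => by
    simp only [lam]; split_ifs <;> linarith
  let Q : Fin k → {q : Fin k → ℝ // (∀ i, 0 ≤ q i) ∧ ∑ i, q i = 1} := fun c =>
    ⟨fun i => (lam i + if i = c then 1 else 0) / n,
      fun i => by have := hlam i; positivity,
      by
        rw [← Finset.sum_div, Finset.sum_add_distrib]
        simp only [lam, Finset.sum_ite_eq', Finset.mem_univ, if_true]
        rw [sub_add_cancel, div_self hn0.ne']⟩
  have hQ : ∀ c i, n * (Q c).1 i = lam i + if i = c then 1 else 0 := fun c i =>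
    mul_div_cancel₀ _ hn0.ne'
  have hdom : ∀ c, ENNReal.ofReal (Real.exp (-1)) •
      Measure.pi (fun i => _root_.poissonMeasure (lam i)) ≤
        Measure.pi (fun i => _root_.poissonMeasure (n * (Q c).1 i)) := fun c => by
    simp only [hQ]
    exact smul_pi_poissonMeasure_le lam hlam c
  have hpa : 4 * pmix n (histMeasure (Q a).1) 1 ≤ (k : ℝ)⁻¹ * Real.exp (-1) := by
    rw [pmix_histMeasure n _ (hIcc _), mul_left_comm]
    gcongr
    rw [Finset.sum_eq_single a]
    · rw [hQ]
      simpa [lam, poi] using four_mul_mul_exp_neg_le hn8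
    · intro i _ hi
      rw [hQ]
      simp [lam, poi, hi]
    · simp
  have hpb : (k : ℝ)⁻¹ * Real.exp (-1) ≤ pmix n (histMeasure (Q b).1) 1 := by
    rw [pmix_histMeasure n _ (hIcc _)]
    gcongr
    refine le_trans (le_of_eq ?_) (Finset.single_le_sum
      (fun i _ => poi_nonneg 1 (mul_nonneg hn0.le ((Q b).2.1 i))) (Finset.mem_univ b))
    rw [hQ]
    simp [lam, poi, hba]
  have := hprob (Q a)
  have := hprob (Q b)
  have : ∀ i, IsProbabilityMeasure (_root_.poissonMeasure (lam i)) := fun i =>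
    isProbabilityMeasure_poissonMeasure (hlam i)
  have key := le_integral_add_integral _ _ _ (Real.exp_pos (-1)).le (hdom a) (hdom b)
    (fun N => hellingerSq (fhat N) (pmix n (histMeasure (Q a).1)))
    (fun N => hellingerSq (fhat N) (pmix n (histMeasure (Q b).1)))
    (fun _ => hellingerSq_nonneg _ _) (fun _ => hellingerSq_nonneg _ _)
    (hle2 (Q a)) (hle2 (Q b))
    (fun N => le_hellingerSq_add_hellingerSq (hfhat N).1
      (pmix_histMeasure_nonneg hn0.le _ (hIcc _)) (pmix_histMeasure_nonneg hn0.le _ (hIcc _))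
      (hfs N) (hasSum_pmix_histMeasure n hk0 _ (hIcc _))
      (hasSum_pmix_histMeasure n hk0 _ (hIcc _)) 1 hpa hpb)
  have ea := le_ciSup hbdd (Q a)
  have eb := le_ciSup hbdd (Q b)
  have hc : Real.exp (-1) * ((k : ℝ)⁻¹ * Real.exp (-1) / 8) =
      2 * (Real.exp (-1) * Real.exp (-1) / 16 / k) := by
    rw [div_eq_mul_inv _ (k : ℝ)]; ring
  rw [hc] at key
  linarith
end

section
/- Let n > 0, D ∈ ℕ, x_0 ∈ ℝ, and let p(x) = Σ_{d=0}^D a_d (x − x_0)^d be a polynomial. Then there exist real coefficients (b_j)_{j∈ℕ} such that p(x) = a_0 + Σ_{j=0}^∞ b_j · poi(j, n x) for all x ≥ 0, and for every j ∈ ℕ, |b_j| ≤ Σ_{d=1}^D |a_d| · ( 2 max( |j/n − x_0| , √(4 j D / n²) ) )^d. -/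
open MeasureTheory ProbabilityTheory Set

/-- The Charlier polynomial `∑ₖ C(d,k) (-u)^(d-k) j(j-1)⋯(j-k+1)`, the function of `j` whose
Poisson mean at parameter `lam` is `(lam - u)^d`. -/
def charlier (u : ℝ) (d j : ℕ) : ℝ :=
  ∑ k ∈ Finset.range (d + 1), (d.choose k : ℝ) * (j.descFactorial k : ℝ) * (-u) ^ (d - k)

theorem hasSum_descFactorial_mul_poi (k : ℕ) (lam : ℝ) :
    HasSum (fun j => (j.descFactorial k : ℝ) * poi j lam) (lam ^ k) := by
  have hexp : HasSum (fun j : ℕ => lam ^ j / (j.factorial : ℝ)) (Real.exp lam) := by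
    rw [Real.exp_eq_exp_ℝ]
    exact NormedSpace.expSeries_div_hasSum_exp lam
  have hshift : HasSum (fun j => ((j + k).descFactorial k : ℝ) * poi (j + k) lam) (lam ^ k) := by
    have h := hexp.mul_left (lam ^ k * Real.exp (-lam))
    rw [mul_assoc, ← Real.exp_add, neg_add_cancel, Real.exp_zero, mul_one] at h
    refine h.congr_fun fun j => ?_
    have hfac : ((j + k).factorial : ℝ) = j.factorial * (j + k).descFactorial k := by
      rw [← Nat.factorial_mul_descFactorial (Nat.le_add_left k j), Nat.add_sub_cancel]
      push_cast
      rfl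
    have hfac_ne : ((j + k).factorial : ℝ) ≠ 0 := by positivity
    have hj : (j.factorial : ℝ) ≠ 0 := by positivity
    have hdesc : ((j + k).descFactorial k : ℝ) ≠ 0 := by
      intro h0
      exact hfac_ne (by rw [hfac, h0, mul_zero])
    rw [poi, hfac, pow_add]
    field_simp
  rw [← hasSum_nat_add_iff' k, Finset.sum_eq_zero, sub_zero]
  · exact hshift
  · intro j hj
    rw [Nat.descFactorial_of_lt (Finset.mem_range.1 hj), Nat.cast_zero, zero_mul]

theorem hasSum_charlier_mul_poi (u : ℝ) (d : ℕ) (lam : ℝ) :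
    HasSum (fun j => charlier u d j * poi j lam) ((lam - u) ^ d) := by
  have h := hasSum_sum (s := Finset.range (d + 1)) fun k _ =>
    (hasSum_descFactorial_mul_poi k lam).mul_left ((d.choose k : ℝ) * (-u) ^ (d - k))
  have hval : (lam - u) ^ d =
      ∑ k ∈ Finset.range (d + 1), (d.choose k : ℝ) * (-u) ^ (d - k) * lam ^ k := by
    rw [sub_eq_add_neg, add_pow]
    exact Finset.sum_congr rfl fun k _ => by ring
  rw [hval]
  refine h.congr_fun fun j => ?_
  rw [charlier, Finset.sum_mul]
  exact Finset.sum_congr rfl fun k _ => by ring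

theorem iteratedDeriv_one_add_pow_mul_cexp (u : ℝ) (d j : ℕ) :
    iteratedDeriv d ((fun z : ℂ => (1 + z) ^ j) * fun z : ℂ => Complex.exp (-u * z)) 0 =
      (charlier u d j : ℂ) := by
  rw [iteratedDeriv_mul (by fun_prop) (by fun_prop), charlier]
  push_cast
  refine Finset.sum_congr rfl fun k _ => ?_
  rw [iteratedDeriv_cexp_const_mul, iteratedDeriv_comp_const_add k (fun z : ℂ => z ^ j) 1]
  simp

theorem norm_one_add_le_exp (z : ℂ) : ‖1 + z‖ ≤ Real.exp (z.re + ‖z‖ ^ 2 / 2) := by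
  refine le_of_sq_le_sq ?_ (Real.exp_pos _).le
  have hexp : Real.exp (z.re + ‖z‖ ^ 2 / 2) ^ 2 = Real.exp (2 * z.re + ‖z‖ ^ 2) := by
    rw [← Real.exp_nat_mul]
    congr 1
    push_cast
    ring
  have hnorm : ‖1 + z‖ ^ 2 = 2 * z.re + ‖z‖ ^ 2 + 1 := by
    simp only [Complex.sq_norm, Complex.normSq_apply, Complex.add_re, Complex.add_im,
      Complex.one_re, Complex.one_im]
    ring
  rw [hexp, hnorm]
  exact Real.add_one_le_exp _

/-- Cauchy's estimate on the circle of radius `r` for the generating function. -/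
theorem abs_charlier_le_cauchy (u : ℝ) (d j : ℕ) {r : ℝ} (hr : 0 < r) :
    |charlier u d j| ≤ d.factorial * Real.exp (|(j : ℝ) - u| * r + j * r ^ 2 / 2) / r ^ d := by
  have h := Complex.norm_iteratedDeriv_le_of_forall_mem_sphere_norm_le
    (f := (fun z : ℂ => (1 + z) ^ j) * fun z : ℂ => Complex.exp (-u * z)) (c := 0)
    (C := Real.exp (|(j : ℝ) - u| * r + j * r ^ 2 / 2)) d hr
    (Differentiable.diffContOnCl (by fun_prop)) ?_
  · rwa [iteratedDeriv_one_add_pow_mul_cexp, Complex.norm_real, Real.norm_eq_abs] at h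
  intro z hz
  have hz : ‖z‖ = r := by simpa using hz
  have hre : |z.re| ≤ r := hz ▸ Complex.abs_re_le_norm z
  calc ‖(1 + z) ^ j * Complex.exp (-u * z)‖
      = ‖1 + z‖ ^ j * Real.exp (-u * z.re) := by simp [Complex.norm_exp]
    _ ≤ Real.exp (z.re + r ^ 2 / 2) ^ j * Real.exp (-u * z.re) := by
        rw [← hz]
        gcongr
        exact norm_one_add_le_exp z
    _ = Real.exp ((j - u) * z.re + j * r ^ 2 / 2) := by
        rw [← Real.exp_nat_mul, ← Real.exp_add]
        congr 1
        ring
    _ ≤ _ := by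
        refine Real.exp_le_exp.2 (add_le_add_left ?_ _)
        calc ((j : ℝ) - u) * z.re ≤ |((j : ℝ) - u) * z.re| := le_abs_self _
          _ = |(j : ℝ) - u| * |z.re| := abs_mul _ _
          _ ≤ _ := by gcongr

theorem exp_nine_eighths_le : Real.exp (9 / 8) ≤ 31 / 10 := by
  refine le_of_pow_le_pow_left₀ (n := 8) (by norm_num) (by norm_num) ?_
  calc Real.exp (9 / 8) ^ 8 = Real.exp 1 ^ 9 := by
        rw [← Real.exp_nat_mul, ← Real.exp_nat_mul]
        norm_num
    _ ≤ 2.7182818286 ^ 9 := by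
        gcongr
        exact Real.exp_one_lt_d9.le
    _ ≤ _ := by norm_num

theorem factorial_mul_pow_le_two_mul_pow {d : ℕ} (hd : 3 ≤ d) :
    (d.factorial : ℝ) * (31 / 10) ^ d ≤ (2 * d) ^ d := by
  induction d, hd using Nat.le_induction with
  | base => norm_num [Nat.factorial]
  | succ d hd ih =>
    have hd0 : (0 : ℝ) < d := by positivity
    have hbern : 2 * (d : ℝ) ^ d ≤ (d + 1) ^ d := by
      have h := one_add_mul_le_pow (a := 1 / (d : ℝ)) (by
        have : 0 < 1 / (d : ℝ) := by positivity
        linarith) d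
      have hsplit : ((d : ℝ) + 1) ^ d = d ^ d * (1 + 1 / d) ^ d := by
        rw [← mul_pow]
        congr 1
        field_simp
      rw [mul_one_div_cancel hd0.ne'] at h
      rw [hsplit]
      nlinarith [pow_pos hd0 d]
    calc ((d + 1).factorial : ℝ) * (31 / 10) ^ (d + 1)
        = (31 / 10) * (d + 1) * (d.factorial * (31 / 10) ^ d) := by
          rw [Nat.factorial_succ]
          push_cast
          ring
      _ ≤ (31 / 10) * (d + 1) * (2 * d) ^ d := by gcongr
      _ = (31 / 20) * (d + 1) * 2 ^ d * (2 * d ^ d) := by rw [mul_pow]; ring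
      _ ≤ 2 * (d + 1) * 2 ^ d * (d + 1) ^ d := by gcongr; norm_num
      _ = (2 * ((d + 1 : ℕ) : ℝ)) ^ (d + 1) := by
          push_cast
          rw [mul_pow]
          ring

theorem abs_charlier_le {u M : ℝ} {d j : ℕ} (hd : 1 ≤ d) (hΔ : |(j : ℝ) - u| ≤ M)
    (hM : 4 * (j : ℝ) * d ≤ M ^ 2) : |charlier u d j| ≤ (2 * M) ^ d := by
  have hM0 : 0 ≤ M := (abs_nonneg _).trans hΔ
  have hj0 : (0 : ℝ) ≤ j := j.cast_nonneg
  obtain rfl | rfl | hd3 : d = 1 ∨ d = 2 ∨ 3 ≤ d := by omega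
  · have hc : charlier u 1 j = j - u := by
      simp [charlier, Finset.sum_range_succ]
      ring
    rw [hc]
    linarith
  · have hc : charlier u 2 j = (j - u) ^ 2 - j := by
      simp only [charlier, Finset.sum_range_succ, Finset.sum_range_zero]
      rw [Nat.cast_descFactorial_two]
      simp
      ring
    have hsq : ((j : ℝ) - u) ^ 2 ≤ M ^ 2 := sq_le_sq' (abs_le.1 hΔ).1 (abs_le.1 hΔ).2
    rw [hc, abs_le]
    push_cast at hM
    constructor <;> nlinarith [sq_nonneg ((j : ℝ) - u)]
  · have hd0 : (0 : ℝ) < d := by positivity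
    obtain rfl | hMpos := hM0.eq_or_lt
    · have hj : j = 0 := by
        have : (j : ℝ) = 0 := by nlinarith
        exact_mod_cast this
      subst hj
      have hu : u = 0 := by simpa using hΔ
      subst hu
      rw [charlier, Finset.sum_eq_zero]
      · simp
      · intro k _
        rcases k with _ | k
        · simp; omega
        · simp
    · calc |charlier u d j|
          ≤ d.factorial * Real.exp (|(j : ℝ) - u| * (d / M) + j * (d / M) ^ 2 / 2) / (d / M) ^ d :=
            abs_charlier_le_cauchy u d j (by positivity)
        _ ≤ d.factorial * Real.exp (d * (9 / 8)) / (d / M) ^ d := by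
            gcongr
            have h1 : |(j : ℝ) - u| * (d / M) ≤ d := by
              calc |(j : ℝ) - u| * (d / M) ≤ M * (d / M) := by gcongr
                _ = d := by field_simp
            have h2 : (j : ℝ) * (d / M) ^ 2 / 2 ≤ d / 8 := by
              rw [div_pow, ← mul_div_assoc, div_div, div_le_div_iff₀ (by positivity) (by norm_num)]
              nlinarith
            linarith
        _ ≤ d.factorial * (31 / 10) ^ d / (d / M) ^ d := by
            rw [Real.exp_nat_mul]
            gcongr
            exact exp_nine_eighths_le
        _ ≤ (2 * d) ^ d / (d / M) ^ d := by
            gcongr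
            exact factorial_mul_pow_le_two_mul_pow hd3
        _ = (2 * M) ^ d := by
            rw [← div_pow]
            congr 1
            field_simp

theorem abs_charlier_div_pow_le {n : ℝ} (hn : 0 < n) {D d : ℕ} (hd : 1 ≤ d) (hdD : d ≤ D)
    (x₀ : ℝ) (j : ℕ) :
    |charlier (n * x₀) d j / n ^ d| ≤
      (2 * max |(j : ℝ) / n - x₀| (Real.sqrt (4 * j * D / n ^ 2))) ^ d := by
  set m := max |(j : ℝ) / n - x₀| (Real.sqrt (4 * j * D / n ^ 2))
  have hΔ : |(j : ℝ) - n * x₀| ≤ n * m := by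
    have hfactor : (j : ℝ) - n * x₀ = n * (j / n - x₀) := by field_simp
    rw [hfactor, abs_mul, abs_of_pos hn]
    gcongr
    exact le_max_left _ _
  have hM : 4 * (j : ℝ) * d ≤ (n * m) ^ 2 := by
    have hsq : 4 * (j : ℝ) * D / n ^ 2 ≤ m ^ 2 :=
      (Real.sqrt_le_left ((abs_nonneg _).trans (le_max_left _ _))).1 (le_max_right _ _)
    calc 4 * (j : ℝ) * d ≤ 4 * j * D := by gcongr
      _ ≤ m ^ 2 * n ^ 2 := (div_le_iff₀ (by positivity)).1 hsq
      _ = (n * m) ^ 2 := by ring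
  rw [abs_div, abs_of_pos (pow_pos hn d), div_le_iff₀ (pow_pos hn d), ← mul_pow]
  calc |charlier (n * x₀) d j| ≤ (2 * (n * m)) ^ d := abs_charlier_le hd hΔ hM
    _ = (2 * m * n) ^ d := by ring

/-- Poisson (Charlier) expansion of a polynomial with coefficient
bounds (Lemma `charlier-bound`). -/
theorem stmt12 (n : ℝ) (hn : 0 < n) (D : ℕ) (x₀ : ℝ) (a : ℕ → ℝ) :
    ∃ b : ℕ → ℝ,
      (∀ x : ℝ, 0 ≤ x →
        Summable (fun j => b j * poi j (n * x)) ∧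
        (∑ d ∈ Finset.range (D + 1), a d * (x - x₀) ^ d) =
          a 0 + ∑' j, b j * poi j (n * x)) ∧
      ∀ j : ℕ, |b j| ≤ ∑ d ∈ Finset.Icc 1 D, |a d| *
        (2 * max |(j : ℝ) / n - x₀| (Real.sqrt (4 * j * D / n ^ 2))) ^ d := by
  refine ⟨fun j => ∑ d ∈ Finset.Icc 1 D, a d * (charlier (n * x₀) d j / n ^ d),
    fun x _ => ?_, fun j => ?_⟩
  · have h : HasSum (fun j => (∑ d ∈ Finset.Icc 1 D, a d * (charlier (n * x₀) d j / n ^ d)) *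
        poi j (n * x)) (∑ d ∈ Finset.Icc 1 D, a d * (x - x₀) ^ d) := by
      have hval : ∑ d ∈ Finset.Icc 1 D, a d * (x - x₀) ^ d =
          ∑ d ∈ Finset.Icc 1 D, a d / n ^ d * (n * x - n * x₀) ^ d := by
        refine Finset.sum_congr rfl fun d _ => ?_
        rw [← mul_sub, mul_pow]
        field_simp
      rw [hval]
      refine (hasSum_sum fun d _ =>
        (hasSum_charlier_mul_poi (n * x₀) d (n * x)).mul_left (a d / n ^ d)).congr_fun fun j => ?_
      rw [Finset.sum_mul]
      exact Finset.sum_congr rfl fun d _ => by ring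
    refine ⟨h.summable, ?_⟩
    rw [h.tsum_eq, Finset.range_eq_Ico, Finset.sum_eq_sum_Ico_succ_bot (Nat.succ_pos D),
      pow_zero, mul_one]
    rfl
  · refine (Finset.abs_sum_le_sum_abs _ _).trans (Finset.sum_le_sum fun d hd => ?_)
    rw [Finset.mem_Icc] at hd
    rw [abs_mul]
    gcongr
    exact abs_charlier_div_pow_le hn hd.1 hd.2 x₀ j
end

section
/- Let λ > 0. For every δ > 0: sup_{x ∈ ℕ, x ≥ (1+δ)λ} √(2π x) · poi(x, λ) ≤ ( e^δ / (1+δ)^{1+δ} )^λ ≤ exp( −(min(δ², δ) λ)/3 ). For every δ ∈ (0,1): sup_{x ∈ ℕ, 0 ≤ x ≤ (1−δ)λ} max(√(2π x), 1) · poi(x, λ) ≤ ( e^{−δ} / (1−δ)^{1−δ} )^λ ≤ exp( −δ² λ / 2 ). -/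
open MeasureTheory ProbabilityTheory Set

open InformationTheory in
lemma klFun_add_log_mul_sub_le {a y : ℝ} (ha : 0 < a) (hy : 0 ≤ y) :
    klFun a + Real.log a * (y - a) ≤ klFun y := by
  rcases hy.eq_or_lt with rfl | hy
  · simp only [klFun_apply, Real.log_zero]
    linarith
  · have h := mul_le_mul_of_nonneg_left (Real.log_le_sub_one_of_pos (div_pos ha hy)) hy.le
    rw [Real.log_div ha.ne' hy.ne', mul_sub, mul_sub, mul_div_cancel₀ _ hy.ne'] at h
    simp only [klFun_apply]
    linarith

open InformationTheory in
lemma monotoneOn_klFun : MonotoneOn klFun (Ici 1) := by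
  intro a (ha : 1 ≤ a) y _ hay
  have h := klFun_add_log_mul_sub_le (a := a) (y := y) (by linarith) (by linarith)
  have := mul_nonneg (Real.log_nonneg ha) (sub_nonneg.2 hay)
  linarith

open InformationTheory in
lemma klFun_le_klFun_of_le_of_le_one {a y : ℝ} (hy : 0 ≤ y) (hya : y ≤ a) (ha : 0 < a)
    (ha1 : a ≤ 1) : klFun a ≤ klFun y := by
  have h := klFun_add_log_mul_sub_le ha hy
  have := mul_nonneg_of_nonpos_of_nonpos (Real.log_nonpos ha.le ha1) (sub_nonpos.2 hya)
  linarith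

open InformationTheory in
lemma min_sq_self_div_three_le_klFun_one_add {δ : ℝ} (hδ : 0 < δ) :
    min (δ ^ 2) δ / 3 ≤ klFun (1 + δ) := by
  have hlog := mul_le_mul_of_nonneg_left (Real.le_log_one_add_of_nonneg hδ.le)
    (by linarith : 0 ≤ 1 + δ)
  have hkl : δ ^ 2 / (δ + 2) ≤ klFun (1 + δ) := by
    rw [klFun_apply]
    have : (1 + δ) * (2 * δ / (δ + 2)) - δ = δ ^ 2 / (δ + 2) := by field_simp; ring
    linarith
  refine le_trans ?_ hkl
  rw [div_le_div_iff₀ (by norm_num) (by linarith)]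
  rcases le_total δ 1 with h | h
  · have := min_le_left (δ ^ 2) δ
    nlinarith [sq_nonneg δ]
  · have := min_le_right (δ ^ 2) δ
    nlinarith

open InformationTheory in
lemma sq_div_two_le_klFun_one_sub {δ : ℝ} (hδ : 0 ≤ δ) (hδ1 : δ < 1) :
    δ ^ 2 / 2 ≤ klFun (1 - δ) := by
  have ha : 0 < 1 - δ := by linarith
  have h := Real.sinh_le_self_iff.2 (Real.log_nonpos ha.le (by linarith))
  rw [Real.sinh_log ha] at h
  have h' := mul_le_mul_of_nonneg_left h ha.le
  have : (1 - δ) * (((1 - δ) - (1 - δ)⁻¹) / 2) = ((1 - δ) ^ 2 - 1) / 2 := by field_simp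
  rw [klFun_apply]
  linarith

open InformationTheory in
lemma exp_sub_one_div_rpow_self_rpow {a lam : ℝ} (ha : 0 < a) :
    (Real.exp (a - 1) / a ^ a) ^ lam = Real.exp (-(lam * klFun a)) := by
  rw [Real.rpow_def_of_pos ha, ← Real.exp_sub, ← Real.exp_mul, klFun_apply]
  ring_nf

open InformationTheory in
lemma exp_neg_mul_klFun_div {x : ℕ} {lam : ℝ} (hlam : 0 < lam) (hx : x ≠ 0) :
    Real.exp (-(lam * klFun (x / lam))) =
      lam ^ x * Real.exp (-lam) / (x / Real.exp 1) ^ x := by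
  have hx' : (0 : ℝ) < x := by positivity
  have hpow : ∀ b : ℝ, 0 < b → b ^ x = Real.exp (x * Real.log b) := fun b hb ↦ by
    rw [Real.exp_nat_mul, Real.exp_log hb]
  rw [hpow lam hlam, hpow _ (by positivity), ← Real.exp_add, ← Real.exp_sub, klFun_apply,
    Real.log_div hx'.ne' hlam.ne', Real.log_div hx'.ne' (Real.exp_ne_zero _), Real.log_exp]
  congr 1
  field_simp
  ring

open InformationTheory in
lemma sqrt_two_pi_mul_poi_le {lam : ℝ} (hlam : 0 < lam) (x : ℕ) :
    Real.sqrt (2 * Real.pi * x) * poi x lam ≤ Real.exp (-(lam * klFun (x / lam))) := by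
  rcases eq_or_ne x 0 with rfl | hx
  · simp [Real.exp_nonneg]
  · rw [exp_neg_mul_klFun_div hlam hx, poi, ← mul_div_assoc,
      div_le_div_iff₀ (by positivity) (by positivity)]
    have := mul_le_mul_of_nonneg_left (Stirling.le_factorial_stirling x)
      (by positivity : 0 ≤ lam ^ x * Real.exp (-lam))
    linarith

open InformationTheory in
lemma max_sqrt_two_pi_one_mul_poi_le {lam : ℝ} (hlam : 0 < lam) (x : ℕ) :
    max (Real.sqrt (2 * Real.pi * x)) 1 * poi x lam ≤
      Real.exp (-(lam * klFun (x / lam))) := by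
  rcases eq_or_ne x 0 with rfl | hx
  · simp [poi, klFun_zero]
  · have hx1 : (1 : ℝ) ≤ x := by exact_mod_cast Nat.one_le_iff_ne_zero.2 hx
    rw [max_eq_left]
    · exact sqrt_two_pi_mul_poi_le hlam x
    · rw [Real.one_le_sqrt]
      nlinarith [Real.pi_gt_three]

/-- pointwise Poisson tail bounds (Lemma `pois-ratio-point`). -/
theorem stmt15 (lam : ℝ) (hlam : 0 < lam) :
    (∀ δ : ℝ, 0 < δ →
      (∀ x : ℕ, (1 + δ) * lam ≤ x →
        Real.sqrt (2 * Real.pi * x) * poi x lam ≤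
          (Real.exp δ / (1 + δ) ^ (1 + δ)) ^ lam) ∧
      (Real.exp δ / (1 + δ) ^ (1 + δ)) ^ lam ≤ Real.exp (-(min (δ ^ 2) δ * lam / 3))) ∧
    (∀ δ : ℝ, 0 < δ → δ < 1 →
      (∀ x : ℕ, (x : ℝ) ≤ (1 - δ) * lam →
        max (Real.sqrt (2 * Real.pi * x)) 1 * poi x lam ≤
          (Real.exp (-δ) / (1 - δ) ^ (1 - δ)) ^ lam) ∧
      (Real.exp (-δ) / (1 - δ) ^ (1 - δ)) ^ lam ≤ Real.exp (-(δ ^ 2 * lam / 2))) := by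
  have hup (δ : ℝ) (hδ : -1 < δ) : (Real.exp δ / (1 + δ) ^ (1 + δ)) ^ lam =
      Real.exp (-(lam * InformationTheory.klFun (1 + δ))) := by
    rw [← exp_sub_one_div_rpow_self_rpow (by linarith), add_sub_cancel_left]
  refine ⟨fun δ hδ ↦ ?_, fun δ hδ hδ1 ↦ ?_⟩
  · rw [hup δ (by linarith)]
    refine ⟨fun x hx ↦ (sqrt_two_pi_mul_poi_le hlam x).trans ?_, ?_⟩
    · have hx' : 1 + δ ≤ x / lam := (le_div_iff₀ hlam).2 hx
      have := monotoneOn_klFun (mem_Ici.2 (by linarith)) (mem_Ici.2 (by linarith)) hx'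
      gcongr
    · rw [Real.exp_le_exp, neg_le_neg_iff, mul_div_right_comm, mul_comm]
      exact mul_le_mul_of_nonneg_left (min_sq_self_div_three_le_klFun_one_add hδ) hlam.le
  · have hlo := hup (-δ) (by linarith)
    rw [← sub_eq_add_neg] at hlo
    rw [hlo]
    refine ⟨fun x hx ↦ (max_sqrt_two_pi_one_mul_poi_le hlam x).trans ?_, ?_⟩
    · have := klFun_le_klFun_of_le_of_le_one (by positivity) ((div_le_iff₀ hlam).2 hx)
        (by linarith) (by linarith)
      gcongr
    · rw [Real.exp_le_exp, neg_le_neg_iff, mul_div_right_comm, mul_comm]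
      exact mul_le_mul_of_nonneg_left (sq_div_two_le_klFun_one_sub hδ.le hδ1) hlam.le
end

section
/- Let n > 0, let S ⊆ [0,1] be an interval, let r : [0,1] → [0,∞), and set t = inf_{x∈[0,1]} min( r(x)²/x , r(x) ). For p ∈ [0,1] let N ~ Poisson(n p) and p̂ = N/n. Then for any constants c_2 > c_1 ≥ 0 there exists a constant c > 0 depending only on c_1 and c_2 such that max( sup_{p ∈ S_{c_1 r}∩[0,1]} P( p̂ ∉ S_{c_2 r} ) , sup_{p ∈ [0,1], p ∉ S_{c_2 r}} P( p̂ ∈ S_{c_1 r} ) ) ≤ 2 exp( −c n t ). -/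
open MeasureTheory ProbabilityTheory Set

noncomputable section

/-- `t = inf_{x ∈ [0,1]} min(r(x)²/x, r(x))` (with the convention
`r(0)²/0 = ∞`, so that the value at `0` is `r(0)`). -/
def tInf (r : ℝ → ℝ) : ℝ :=
  min (r 0) (⨅ x : (Set.Ioc (0:ℝ) 1), min ((r x) ^ 2 / x) (r x))

end

theorem hasSum_poi_mul_exp (lam θ : ℝ) :
    HasSum (fun j : ℕ => poi j lam * Real.exp (θ * j)) (Real.exp (lam * (Real.exp θ - 1))) := by
  have h := (NormedSpace.expSeries_div_hasSum_exp (lam * Real.exp θ)).mul_left (Real.exp (-lam))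
  rw [← Real.exp_eq_exp_ℝ, ← Real.exp_add] at h
  have hfun : (fun j : ℕ => poi j lam * Real.exp (θ * j)) =
      fun j : ℕ => Real.exp (-lam) * ((lam * Real.exp θ) ^ j / j.factorial) := by
    ext j
    rw [poi, mul_pow, ← Real.exp_nat_mul, mul_comm θ]
    ring
  rwa [hfun, show lam * (Real.exp θ - 1) = -lam + lam * Real.exp θ by ring]

/-- Chernoff's bound for the Poisson distribution. -/
theorem poissonMeasure_le_exp {lam : ℝ} (hlam : 0 ≤ lam) (θ a : ℝ) {A : Set ℕ}
    (hA : ∀ j ∈ A, θ * a ≤ θ * j) :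
    _root_.poissonMeasure lam A ≤
      ENNReal.ofReal (Real.exp (lam * (Real.exp θ - 1) - θ * a)) := by
  have hpoi : ∀ j, 0 ≤ poi j lam := fun j => by unfold poi; positivity
  have hsum := (hasSum_poi_mul_exp lam θ).mul_right (Real.exp (-(θ * a)))
  rw [← Real.exp_add, ← sub_eq_add_neg] at hsum
  rw [← hsum.tsum_eq, ENNReal.ofReal_tsum_of_nonneg
    (fun j => mul_nonneg (mul_nonneg (hpoi j) (Real.exp_nonneg _)) (Real.exp_nonneg _))
    hsum.summable, _root_.poissonMeasure, Measure.sum_apply _ (MeasurableSet.of_discrete)]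
  refine ENNReal.tsum_le_tsum fun j => ?_
  rw [Measure.smul_apply, Measure.dirac_apply, smul_eq_mul]
  by_cases hj : j ∈ A
  · rw [indicator_of_mem hj, Pi.one_apply, mul_one]
    refine ENNReal.ofReal_le_ofReal ?_
    rw [mul_assoc, ← Real.exp_add]
    refine le_mul_of_one_le_right (hpoi j) (Real.one_le_exp ?_)
    linarith [hA j hj]
  · simp [indicator_of_notMem hj]

/-- Bernstein-type bound: a set of integers lying beyond `m`, as seen from the mean `lam`. -/
theorem poissonMeasure_le_exp_sq {lam m B : ℝ} (hlam : 0 ≤ lam) (hB : 0 < B) (hlamB : lam ≤ B)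
    (hmB : |m - lam| ≤ B) {A : Set ℕ} (hA : ∀ j ∈ A, 0 ≤ (m - lam) * (j - m)) :
    _root_.poissonMeasure lam A ≤ ENNReal.ofReal (Real.exp (-((m - lam) ^ 2 / (4 * B)))) := by
  set θ := (m - lam) / (2 * B) with hθ
  have hθ1 : |θ| ≤ 1 := by
    rw [hθ, abs_div, abs_of_pos (by positivity : 0 < 2 * B), div_le_one (by positivity)]
    linarith
  refine (poissonMeasure_le_exp hlam θ m fun j hj => ?_).trans
    (ENNReal.ofReal_le_ofReal (Real.exp_le_exp.2 ?_))
  · have : θ * j - θ * m = (m - lam) * (j - m) / (2 * B) := by rw [hθ]; ring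
    have : 0 ≤ (m - lam) * (j - m) / (2 * B) := div_nonneg (hA j hj) (by positivity)
    linarith
  · have h1 : Real.exp θ - 1 ≤ θ + θ ^ 2 := by
      linarith [(abs_le.1 (Real.abs_exp_sub_one_sub_id_le hθ1)).2]
    have h2 : lam * (Real.exp θ - 1) ≤ lam * (θ + θ ^ 2) := mul_le_mul_of_nonneg_left h1 hlam
    have h3 : lam * θ ^ 2 ≤ B * θ ^ 2 := mul_le_mul_of_nonneg_right hlamB (sq_nonneg θ)
    have h4 : B * θ ^ 2 - θ * (m - lam) = -((m - lam) ^ 2 / (4 * B)) := by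
      rw [hθ]
      field_simp
      ring
    linarith

theorem poissonMeasure_le_of_deviation {n p t κ K : ℝ} (hn : 0 < n) (hp : 0 ≤ p) (hκ : 0 < κ)
    (hK : 0 < K) {m : ℕ} (hsq : κ ^ 2 * t * max p (m / n) ≤ K * (m / n - p) ^ 2)
    (hlin : κ * t ≤ |m / n - p|) {A : Set ℕ}
    (hA : ∀ j ∈ A, 0 ≤ ((m : ℝ) / n - p) * (j - m)) :
    _root_.poissonMeasure (n * p) A ≤
      ENNReal.ofReal (Real.exp (-(κ ^ 2 / (4 * K) * n * t))) := by
  have hq : (0 : ℝ) ≤ m / n := by positivity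
  have hm : (m : ℝ) - n * p = n * (m / n - p) := by field_simp
  have hM0 : 0 ≤ max p (m / n) := hp.trans (le_max_left _ _)
  have hA' : ∀ j ∈ A, 0 ≤ ((m : ℝ) - n * p) * (j - m) := fun j hj => by
    rw [hm, mul_assoc]
    exact mul_nonneg hn.le (hA j hj)
  rcases hM0.eq_or_lt with hM | hM
  · have hp0 : p = 0 := le_antisymm (hM ▸ le_max_left _ _) hp
    have hq0 : (m : ℝ) / n = 0 := le_antisymm (hM ▸ le_max_right _ _) hq
    have ht : t ≤ 0 := by
      rw [hq0, hp0, sub_zero, abs_zero] at hlin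
      exact nonpos_of_mul_nonpos_right hlin hκ
    refine (poissonMeasure_le_exp (mul_nonneg hn.le hp) 0 0 (by simp)).trans
      (ENNReal.ofReal_le_ofReal (Real.exp_le_exp.2 ?_))
    have : κ ^ 2 / (4 * K) * n * t ≤ 0 := mul_nonpos_of_nonneg_of_nonpos (by positivity) ht
    simpa using this
  · refine (poissonMeasure_le_exp_sq (B := n * max p (m / n)) (mul_nonneg hn.le hp) (by positivity)
      (by gcongr; exact le_max_left _ _) ?_ hA').trans
      (ENNReal.ofReal_le_ofReal (Real.exp_le_exp.2 (neg_le_neg ?_)))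
    · rw [hm, abs_mul, abs_of_pos hn]
      gcongr
      rw [abs_le]
      constructor <;> linarith [le_max_left p (m / n), le_max_right p (m / n)]
    · rw [hm, le_div_iff₀ (by positivity)]
      calc κ ^ 2 / (4 * K) * n * t * (4 * (n * max p (m / n)))
          = n ^ 2 / K * (κ ^ 2 * t * max p (m / n)) := by field_simp
        _ ≤ n ^ 2 / K * (K * (m / n - p) ^ 2) := by gcongr
        _ = (n * (m / n - p)) ^ 2 := by field_simp

theorem poissonMeasure_upper_le {n p t κ K : ℝ} (hn : 0 < n) (hp : 0 ≤ p) (hκ : 0 < κ)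
    (hK : 0 < K) {A : Set ℕ}
    (hA : ∀ j ∈ A, κ ^ 2 * t * (j / n) ≤ K * (j / n - p) ^ 2 ∧ κ * t ≤ j / n - p ∧
      p ≤ j / n) :
    _root_.poissonMeasure (n * p) A ≤
      ENNReal.ofReal (Real.exp (-(κ ^ 2 / (4 * K) * n * t))) := by
  rcases A.eq_empty_or_nonempty with rfl | hne
  · simp
  · obtain ⟨h1, h2, h3⟩ := hA _ (Nat.sInf_mem hne)
    refine poissonMeasure_le_of_deviation (m := sInf A) hn hp hκ hK ?_ (h2.trans (le_abs_self _))
      fun j hj => mul_nonneg (sub_nonneg.2 h3) (sub_nonneg.2 ?_)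
    · rwa [max_eq_right h3]
    · exact_mod_cast Nat.sInf_le hj

theorem poissonMeasure_lower_le {n p t κ K : ℝ} (hn : 0 < n) (hp : 0 ≤ p) (hκ : 0 < κ)
    (hK : 0 < K) {A : Set ℕ}
    (hA : ∀ j ∈ A, κ ^ 2 * t * p ≤ K * (p - j / n) ^ 2 ∧ κ * t ≤ p - j / n ∧
      (j : ℝ) / n ≤ p) :
    _root_.poissonMeasure (n * p) A ≤
      ENNReal.ofReal (Real.exp (-(κ ^ 2 / (4 * K) * n * t))) := by
  rcases A.eq_empty_or_nonempty with rfl | hne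
  · simp
  · have hbdd : BddAbove A := by
      refine ⟨⌊n * p⌋₊, fun j hj => Nat.le_floor ?_⟩
      have := (div_le_iff₀ hn).1 (hA j hj).2.2
      linarith
    obtain ⟨h1, h2, h3⟩ := hA _ (Nat.sSup_mem hne hbdd)
    refine poissonMeasure_le_of_deviation (m := sSup A) hn hp hκ hK ?_ ?_
      fun j hj => mul_nonneg_of_nonpos_of_nonpos (sub_nonpos.2 h3) (sub_nonpos.2 ?_)
    · rwa [max_eq_left h3, sub_sq_comm]
    · rw [abs_sub_comm]
      exact h2.trans (le_abs_self _)
    · exact_mod_cast le_csSup hbdd hj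

theorem tInf_nonneg {r : ℝ → ℝ} (hr : ∀ x, 0 ≤ r x) : 0 ≤ tInf r :=
  le_min (hr 0) (Real.iInf_nonneg fun x =>
    le_min (div_nonneg (sq_nonneg _) x.2.1.le) (hr x))

theorem tInf_le {r : ℝ → ℝ} (hr : ∀ x, 0 ≤ r x) {x : ℝ} (hx : x ∈ Set.Icc (0 : ℝ) 1) :
    tInf r ≤ r x ∧ tInf r * x ≤ r x ^ 2 := by
  rcases hx.1.eq_or_lt with rfl | h0
  · exact ⟨min_le_left _ _, by simpa using sq_nonneg (r 0)⟩
  · have hbdd : BddBelow (Set.range fun x : Set.Ioc (0 : ℝ) 1 => min (r x ^ 2 / x) (r x)) :=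
      ⟨0, by
        rintro _ ⟨y, rfl⟩
        exact le_min (div_nonneg (sq_nonneg _) y.2.1.le) (hr y)⟩
    have h : tInf r ≤ min (r x ^ 2 / x) (r x) :=
      (min_le_right _ _).trans (ciInf_le hbdd ⟨x, h0, hx.2⟩)
    exact ⟨h.trans (min_le_right _ _), (le_div_iff₀ h0).1 (h.trans (min_le_left _ _))⟩

/-- The relative squared deviation `δ² / M` is of order at least `t` when `M` exceeds `x + c ρ` by
at most `e` and `δ` is at least `κ ρ + e`. -/
theorem deviation_bounds {t x ρ κ c e M δ : ℝ} (ht : 0 ≤ t) (htρ : t ≤ ρ) (htx : t * x ≤ ρ ^ 2)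
    (hκ : 0 < κ) (hκc : κ ≤ c) (he : 0 ≤ e) (hM : M ≤ x + c * ρ + e) (hδ : κ * ρ + e ≤ δ) :
    κ ^ 2 * t * M ≤ (1 + c) * δ ^ 2 ∧ κ * t ≤ δ ∧ 0 ≤ δ := by
  have hρ : 0 ≤ ρ := ht.trans htρ
  have hκρ : 0 ≤ κ * ρ := by positivity
  have hc : 0 ≤ c := hκ.le.trans hκc
  refine ⟨?_, ?_, by linarith⟩
  · have h1 : t * M ≤ (1 + c) * ρ ^ 2 + ρ * e := by
      have h2 : t * M ≤ t * (x + c * ρ + e) := mul_le_mul_of_nonneg_left hM ht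
      have h3 : c * (t * ρ) ≤ c * (ρ * ρ) := by gcongr
      have h4 : t * e ≤ ρ * e := by gcongr
      linarith
    have h5 : (κ * ρ + e) ^ 2 ≤ δ ^ 2 := by gcongr
    have h6 : κ * (κ * (ρ * e)) ≤ (1 + c) * (κ * (ρ * e)) := by
      gcongr
      linarith
    have h7 : 0 ≤ (1 + c) * (κ * (ρ * e)) := by positivity
    have h8 : 0 ≤ (1 + c) * e ^ 2 := by positivity
    have h9 : (1 + c) * (κ * ρ + e) ^ 2 ≤ (1 + c) * δ ^ 2 := by gcongr
    have h10 : κ ^ 2 * (t * M) ≤ κ ^ 2 * ((1 + c) * ρ ^ 2 + ρ * e) := by gcongr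
    linarith
  · have : κ * t ≤ κ * ρ := by gcongr
    linarith

theorem mem_fatten {r : ℝ → ℝ} {S : Set ℝ} {y : ℝ} :
    y ∈ fatten r S ↔ ∃ x ∈ S, x - r x ≤ y ∧ y ≤ x + r x := by
  simp only [fatten, mem_iUnion, mem_Icc, exists_prop]

theorem lt_or_lt_of_notMem_fatten {r : ℝ → ℝ} {S : Set ℝ} (hS : S.OrdConnected)
    (hr : ∀ x, 0 ≤ r x) {p : ℝ} (hp : p ∉ fatten r S) :
    (∀ x ∈ S, p < x - r x) ∨ ∀ x ∈ S, x + r x < p := by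
  by_contra! h
  obtain ⟨⟨x, hx, hpx⟩, y, hy, hpy⟩ := h
  have hx' : x + r x < p := not_le.1 fun h' => hp (mem_fatten.2 ⟨x, hx, hpx, h'⟩)
  have hy' : p < y - r y := not_le.1 fun h' => hp (mem_fatten.2 ⟨y, hy, h', hpy⟩)
  have hpS : p ∈ S := hS.out hx hy ⟨by linarith [hr x], by linarith [hr y]⟩
  exact hp (mem_fatten.2 ⟨p, hpS, by linarith [hr p], by linarith [hr p]⟩)

/-- Poisson localization of the empirical frequency
(Lemma `pois_rn`); the constant `c` depends only on `c₁, c₂`. -/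
theorem stmt16 :
    ∀ c₁ c₂ : ℝ, 0 ≤ c₁ → c₁ < c₂ →
    ∃ c : ℝ, 0 < c ∧
    ∀ (n : ℝ), 0 < n →
    ∀ S : Set ℝ, S ⊆ Set.Icc 0 1 → S.OrdConnected →
    ∀ r : ℝ → ℝ, (∀ x, 0 ≤ r x) →
    ∀ p ∈ Set.Icc (0:ℝ) 1,
      (p ∈ fatten (fun x => c₁ * r x) S →
        poissonMeasure (n * p) {j : ℕ | (j : ℝ) / n ∉ fatten (fun x => c₂ * r x) S} ≤
          ENNReal.ofReal (2 * Real.exp (-(c * n * tInf r)))) ∧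
      (p ∉ fatten (fun x => c₂ * r x) S →
        poissonMeasure (n * p) {j : ℕ | (j : ℝ) / n ∈ fatten (fun x => c₁ * r x) S} ≤
          ENNReal.ofReal (2 * Real.exp (-(c * n * tInf r)))) := by
  intro c₁ c₂ hc₁ hc
  have hκ : 0 < c₂ - c₁ := sub_pos.2 hc
  have hκc : c₂ - c₁ ≤ c₂ := by linarith
  have hK : 0 < 1 + c₂ := by linarith
  refine ⟨(c₂ - c₁) ^ 2 / (4 * (1 + c₂)), by positivity, ?_⟩
  intro n hn S hS hconn r hr p hp
  have ht := tInf_nonneg hr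
  have hmul : ∀ x, c₁ * r x ≤ c₂ * r x := fun x => mul_le_mul_of_nonneg_right hc.le (hr x)
  have hdouble : ENNReal.ofReal
      (2 * Real.exp (-((c₂ - c₁) ^ 2 / (4 * (1 + c₂)) * n * tInf r))) =
      ENNReal.ofReal (Real.exp (-((c₂ - c₁) ^ 2 / (4 * (1 + c₂)) * n * tInf r))) +
      ENNReal.ofReal (Real.exp (-((c₂ - c₁) ^ 2 / (4 * (1 + c₂)) * n * tInf r))) := by
    rw [two_mul, ENNReal.ofReal_add (Real.exp_nonneg _) (Real.exp_nonneg _)]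
  rw [hdouble]
  constructor
  · intro hpf
    obtain ⟨x, hx, h1, h2⟩ := mem_fatten.1 hpf
    obtain ⟨htr, htx⟩ := tInf_le hr (hS hx)
    have hsub : {j : ℕ | (j : ℝ) / n ∉ fatten (fun x => c₂ * r x) S} ⊆
        {j : ℕ | x + c₂ * r x < j / n} ∪ {j : ℕ | (j : ℝ) / n < x - c₂ * r x} := by
      intro j hj
      by_contra hcon
      simp only [mem_union, mem_ofPred_eq, not_or, not_lt] at hcon
      exact hj (mem_fatten.2 ⟨x, hx, hcon.2, hcon.1⟩)
    refine (measure_mono hsub).trans ((measure_union_le _ _).trans (add_le_add ?_ ?_))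
    · refine poissonMeasure_upper_le hn hp.1 hκ hK fun j hj => ?_
      rw [mem_ofPred_eq] at hj
      rw [← sub_nonneg (b := p)]
      exact deviation_bounds (e := j / n - (x + c₂ * r x)) ht htr htx hκ hκc
        (by linarith) (by linarith) (by linarith)
    · refine poissonMeasure_lower_le hn hp.1 hκ hK fun j hj => ?_
      rw [mem_ofPred_eq] at hj
      rw [← sub_nonneg (a := p)]
      exact deviation_bounds (e := 0) ht htr htx hκ hκc le_rfl (by linarith [hmul x])
        (by linarith)
  · intro hpf
    refine le_add_right ?_
    rcases lt_or_lt_of_notMem_fatten hconn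
      (fun x => mul_nonneg (hc₁.trans hc.le) (hr x)) hpf with h | h
    · refine poissonMeasure_upper_le hn hp.1 hκ hK fun j hj => ?_
      obtain ⟨x, hx, h1, h2⟩ := mem_fatten.1 hj
      obtain ⟨htr, htx⟩ := tInf_le hr (hS hx)
      have hpx := h x hx
      rw [← sub_nonneg (b := p)]
      exact deviation_bounds (e := 0) ht htr htx hκ hκc le_rfl (by linarith [hmul x])
        (by linarith)
    · refine poissonMeasure_lower_le hn hp.1 hκ hK fun j hj => ?_
      obtain ⟨x, hx, h1, h2⟩ := mem_fatten.1 hj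
      obtain ⟨htr, htx⟩ := tInf_le hr (hS hx)
      have hpx := h x hx
      rw [← sub_nonneg (a := p)]
      exact deviation_bounds (e := p - (x + c₂ * r x)) ht htr htx hκ hκc
        (by linarith) (by linarith) (by linarith)
end

section
/- There exists a universal constant C > 0 such that for every ε ∈ (0, 1/2) and every 0 < a < b, and every Borel probability measure P on [a,b], there exists a probability measure Q supported on at most C·( (√b − √a) (log(1/ε))^{3/2} + (log(1/ε))² ) points of [a,b] such that sup_{j∈ℕ} | f_P(j) − f_Q(j) | ≤ ε. -/
open MeasureTheory ProbabilityTheory Set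

/-- Tail estimate for the Taylor series of an entire function bounded on a unit circle. -/
theorem norm_sub_taylor_le {f : ℂ → ℂ} (hf : Differentiable ℂ f) {c : ℂ} {M : ℝ}
    (hM : ∀ z ∈ Metric.sphere c 1, ‖f z‖ ≤ M) (d : ℕ) {z : ℂ} (hz : ‖z - c‖ ≤ 1 / 2) :
    ‖f z - ∑ k ∈ Finset.range d, (k.factorial : ℂ)⁻¹ * iteratedDeriv k f c * (z - c) ^ k‖
      ≤ 2 * M * (1 / 2) ^ d := by
  have hterm (k : ℕ) :
      ‖(k.factorial : ℂ)⁻¹ * iteratedDeriv k f c * (z - c) ^ k‖ ≤ M * (1 / 2) ^ k := by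
    have h := Complex.norm_iteratedDeriv_le_of_forall_mem_sphere_norm_le k one_pos
      hf.diffContOnCl hM
    have hk : (0 : ℝ) < k.factorial := by positivity
    have h1 : ‖(k.factorial : ℂ)⁻¹ * iteratedDeriv k f c‖ ≤ M := by
      rw [norm_mul, norm_inv, Complex.norm_natCast, inv_mul_le_iff₀ hk]
      simpa using h
    rw [norm_mul, norm_pow]
    exact mul_le_mul h1 (pow_le_pow_left₀ (norm_nonneg _) hz k) (by positivity)
      ((norm_nonneg _).trans h1)
  have hsum : HasSum (fun k : ℕ ↦ (k.factorial : ℂ)⁻¹ * iteratedDeriv k f c * (z - c) ^ k)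
      (f z) := by
    have h := Complex.hasSum_taylorSeries_of_entire hf c z
    have heq : (fun k : ℕ ↦ (k.factorial : ℂ)⁻¹ • (z - c) ^ k • iteratedDeriv k f c) =
        fun k ↦ (k.factorial : ℂ)⁻¹ * iteratedDeriv k f c * (z - c) ^ k := by
      funext k
      simp only [smul_eq_mul]
      ring
    rwa [heq] at h
  have htail := (hasSum_nat_add_iff' d).2 hsum
  have hgeom : HasSum (fun k : ℕ ↦ M * (1 / 2 : ℝ) ^ (k + d)) (2 * M * (1 / 2) ^ d) := by
    have h := hasSum_geometric_two.mul_left (M * (1 / 2 : ℝ) ^ d)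
    have heq : (fun k : ℕ ↦ M * (1 / 2 : ℝ) ^ d * (1 / 2) ^ k) =
        fun k ↦ M * (1 / 2 : ℝ) ^ (k + d) := by
      funext k
      ring
    rwa [heq, show M * (1 / 2 : ℝ) ^ d * 2 = 2 * M * (1 / 2) ^ d by ring] at h
  rw [← htail.tsum_eq]
  exact tsum_of_norm_bounded hgeom fun k ↦ hterm (k + d)

/-- The entire function extending `s ↦ poi j (s ^ 2)`. -/
noncomputable def poiSq (j : ℕ) (z : ℂ) : ℂ := z ^ (2 * j) * Complex.exp (-z ^ 2) / (j.factorial : ℂ)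

theorem differentiable_poiSq (j : ℕ) : Differentiable ℂ (poiSq j) := by
  unfold poiSq
  fun_prop

theorem poiSq_ofReal (j : ℕ) (s : ℝ) : poiSq j s = (poi j (s ^ 2) : ℂ) := by
  simp [poiSq, poi, pow_mul]

theorem poi_nonneg_s17 (j : ℕ) {x : ℝ} (hx : 0 ≤ x) : 0 ≤ poi j x := by
  unfold poi
  positivity

theorem poi_le_one (j : ℕ) {x : ℝ} (hx : 0 ≤ x) : poi j x ≤ 1 := by
  have h := Real.pow_div_factorial_le_exp x hx j
  calc poi j x = x ^ j / j.factorial * Real.exp (-x) := by unfold poi; ring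
    _ ≤ Real.exp x * Real.exp (-x) := by gcongr
    _ = 1 := by rw [← Real.exp_add]; simp

theorem norm_poiSq_le (j : ℕ) (z : ℂ) : ‖poiSq j z‖ ≤ Real.exp (2 * z.im ^ 2) := by
  have hexp : Real.exp (-z ^ 2).re = Real.exp (-‖z‖ ^ 2) * Real.exp (2 * z.im ^ 2) := by
    rw [← Real.exp_add, Complex.sq_norm, Complex.normSq_apply]
    congr 1
    simp only [Complex.neg_re, pow_two, Complex.mul_re]
    ring
  have h : ‖poiSq j z‖ = poi j (‖z‖ ^ 2) * Real.exp (2 * z.im ^ 2) := by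
    rw [poiSq, norm_div, norm_mul, norm_pow, Complex.norm_exp, Complex.norm_natCast, hexp, poi,
      ← pow_mul]
    ring
  rw [h]
  exact mul_le_of_le_one_left (Real.exp_pos _).le (poi_le_one j (by positivity))

/-- The `k`-th Taylor coefficient at `c` of `s ↦ poi j (s ^ 2)`. -/
noncomputable def poiSqCoeff (j : ℕ) (c : ℝ) (k : ℕ) : ℝ :=
  ((k.factorial : ℂ)⁻¹ * iteratedDeriv k (poiSq j) c).re

theorem norm_poiSq_le_of_mem_sphere (j : ℕ) (c : ℝ) :
    ∀ z ∈ Metric.sphere (c : ℂ) 1, ‖poiSq j z‖ ≤ Real.exp 2 := by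
  intro z hz
  refine (norm_poiSq_le j z).trans (Real.exp_le_exp.2 ?_)
  have h1 : |z.im| ≤ 1 := by
    have h := Complex.abs_im_le_norm (z - c)
    rw [mem_sphere_iff_norm] at hz
    simpa [hz] using h
  have := (sq_le_one_iff_abs_le_one z.im).2 h1
  linarith

theorem abs_poiSqCoeff_le (j : ℕ) (c : ℝ) (k : ℕ) : |poiSqCoeff j c k| ≤ Real.exp 2 := by
  refine (Complex.abs_re_le_norm _).trans ?_
  have h := Complex.norm_iteratedDeriv_le_of_forall_mem_sphere_norm_le k one_pos
    (differentiable_poiSq j).diffContOnCl (norm_poiSq_le_of_mem_sphere j c)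
  have hk : (0 : ℝ) < k.factorial := by positivity
  rw [norm_mul, norm_inv, Complex.norm_natCast, inv_mul_le_iff₀ hk]
  simpa using h

theorem abs_poi_sub_taylor_le (j d : ℕ) {c θ : ℝ} (hθ : 0 ≤ θ) (hc : |√θ - c| ≤ 1 / 2) :
    |poi j θ - ∑ k ∈ Finset.range d, poiSqCoeff j c k * (√θ - c) ^ k|
      ≤ 2 * Real.exp 2 * (1 / 2) ^ d := by
  have hz : ‖((√θ : ℝ) : ℂ) - c‖ ≤ 1 / 2 := by
    rw [← Complex.ofReal_sub, Complex.norm_real]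
    exact hc
  refine le_trans (le_of_eq_of_le ?_ (Complex.abs_re_le_norm _))
    (norm_sub_taylor_le (differentiable_poiSq j) (norm_poiSq_le_of_mem_sphere j c) d hz)
  rw [Complex.sub_re, Complex.re_sum, poiSq_ofReal, Real.sq_sqrt hθ, Complex.ofReal_re]
  congr 2
  refine Finset.sum_congr rfl fun k _ ↦ ?_
  rw [← Complex.ofReal_sub, ← Complex.ofReal_pow, Complex.re_mul_ofReal, poiSqCoeff]

/-- Carathéodory quadrature: if each function `f j` is uniformly close to a linear functional of a
feature map `Φ` into a finite-dimensional space, then `P` can be replaced by a measure with at most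
`finrank + 1` atoms without changing the integrals of the `f j` by much. -/
theorem exists_finite_support_approx {ι E : Type*} [NormedAddCommGroup E] [NormedSpace ℝ E]
    [FiniteDimensional ℝ E] {P : Measure ℝ} [IsProbabilityMeasure P] {I : Set ℝ} {Φ : ℝ → E}
    {K : Set E} (f : ι → ℝ → ℝ) (l : ι → E →L[ℝ] ℝ) {η M : ℝ} (hη : 0 < η)
    (hΦ : Integrable Φ P) (hf : ∀ j, Integrable (f j) P) (hK : ∀ᵐ θ ∂P, Φ θ ∈ K)
    (hM : ∀ j, ‖l j‖ ≤ M) (hfΦ : ∀ j, ∀ᵐ θ ∂P, |f j θ - l j (Φ θ)| ≤ η)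
    (hτ : ∀ p ∈ K, ∃ θ ∈ I, ∀ j, |f j θ - l j p| ≤ η) :
    ∃ Q : Measure ℝ, IsProbabilityMeasure Q ∧ ∃ S : Finset ℝ, (S : Set ℝ) ⊆ I ∧
      Q ((S : Set ℝ))ᶜ = 0 ∧ S.card ≤ Module.finrank ℝ E + 1 ∧
      ∀ j, |(∫ θ, f j θ ∂P) - ∫ θ, f j θ ∂Q| ≤ 3 * η := by
  classical
  have hmem : ∫ θ, Φ θ ∂P ∈ closure (convexHull ℝ K) :=
    (convex_convexHull ℝ K).closure.integral_mem isClosed_closure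
      (hK.mono fun θ h ↦ subset_closure (subset_convexHull ℝ K h)) hΦ
  obtain ⟨y, hy, hdist⟩ := Metric.mem_closure_iff.1 hmem (η / (|M| + 1)) (by positivity)
  obtain ⟨κ, _, z, w, hzK, hind, hw, hw1, hwz⟩ := eq_pos_convex_span_of_mem_convexHull hy
  choose t htI ht using fun i ↦ hτ (z i) (hzK ⟨i, rfl⟩)
  let Q : Measure ℝ := ∑ i, ENNReal.ofReal (w i) • Measure.dirac (t i)
  have hint (g : ℝ → ℝ) : ∫ θ, g θ ∂Q = ∑ i, w i * g (t i) := by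
    rw [integral_finsetSum_measure fun i _ ↦
      (integrable_dirac (by simp)).smul_measure ENNReal.ofReal_ne_top]
    simp [integral_smul_measure, ENNReal.toReal_ofReal (hw _).le]
  refine ⟨Q, ⟨?_⟩, Finset.univ.image t, ?_, ?_, ?_, fun j ↦ ?_⟩
  · simp only [Q, Measure.finsetSum_apply, Measure.smul_apply, measure_univ, smul_eq_mul, mul_one]
    rw [← ENNReal.ofReal_sum_of_nonneg fun i _ ↦ (hw i).le, hw1, ENNReal.ofReal_one]
  · simpa [Set.range_subset_iff] using htI
  · simp only [Q, Measure.finsetSum_apply, Measure.smul_apply, smul_eq_mul]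
    refine Finset.sum_eq_zero fun i _ ↦ ?_
    rw [Measure.dirac_apply' _ (Finset.measurableSet _).compl]
    simp
  · refine Finset.card_image_le.trans ?_
    exact hind.card_le_finrank_succ.trans (by gcongr; exact Submodule.finrank_le _)
  · have h1 : |(∫ θ, f j θ ∂P) - l j (∫ θ, Φ θ ∂P)| ≤ η := by
      rw [← (l j).integral_comp_comm hΦ, ← integral_sub (hf j) ((l j).integrable_comp hΦ)]
      have h : ∀ᵐ θ ∂P, ‖f j θ - l j (Φ θ)‖ ≤ η := hfΦ j
      simpa using norm_integral_le_of_norm_le_const h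
    have h2 : |l j (∫ θ, Φ θ ∂P) - l j y| ≤ η := by
      rw [← map_sub, ← Real.norm_eq_abs]
      refine ((l j).le_opNorm _).trans ?_
      rw [← dist_eq_norm]
      calc ‖l j‖ * dist (∫ θ, Φ θ ∂P) y ≤ (|M| + 1) * (η / (|M| + 1)) := by
            gcongr
            exact (hM j).trans ((le_abs_self M).trans (by linarith))
        _ = η := by field_simp
    have h3 : |l j y - ∫ θ, f j θ ∂Q| ≤ η := by
      rw [hint, ← hwz, map_sum, ← Finset.sum_sub_distrib]
      refine (Finset.abs_sum_le_sum_abs _ _).trans ?_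
      calc ∑ i, |l j (w i • z i) - w i * f j (t i)| ≤ ∑ i, w i * η := by
            refine Finset.sum_le_sum fun i _ ↦ ?_
            rw [map_smul, smul_eq_mul, ← mul_sub, abs_mul, abs_of_pos (hw i), abs_sub_comm]
            exact mul_le_mul_of_nonneg_left (ht i j) (hw i).le
        _ = η := by rw [← Finset.sum_mul, hw1, one_mul]
    rw [abs_le] at *
    constructor <;> linarith [h1.1, h1.2, h2.1, h2.2, h3.1, h3.2]

/-- Poisson mixtures on `[a, b]` are approximated by mixtures with `d` atoms per unit length in the
variance-stabilized variable `√θ`, with error exponentially small in `d`. -/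
theorem exists_finite_poisson_mixture {a b : ℝ} (ha : 0 < a) {P : Measure ℝ}
    (hP : IsProbOn P (Set.Icc a b)) (d : ℕ) {η : ℝ} (hη : 0 < η)
    (hd : 2 * Real.exp 2 * (1 / 2) ^ d ≤ η) :
    ∃ Q : Measure ℝ, IsProbabilityMeasure Q ∧ ∃ S : Finset ℝ, (S : Set ℝ) ⊆ Set.Icc a b ∧
      Q ((S : Set ℝ))ᶜ = 0 ∧ S.card ≤ (⌊√b - √a⌋₊ + 1) * d + 1 ∧
      ∀ j, |pmixT P j - pmixT Q j| ≤ 3 * η := by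
  obtain ⟨hprob, hsupp⟩ := hP
  have hae : ∀ᵐ θ ∂P, θ ∈ Set.Icc a b := hsupp
  set m := ⌊√b - √a⌋₊ + 1
  let c : ℕ → ℝ := fun i ↦ √a + i + 1 / 2
  let cell : ℝ → ℕ := fun θ ↦ ⌊√θ - √a⌋₊
  let ψ : ℕ → ℝ → Fin m × Fin d → ℝ := fun i θ p ↦
    if i = p.1 then (√θ - c i) ^ (p.2 : ℕ) else 0
  let Φ : ℝ → Fin m × Fin d → ℝ := fun θ ↦ ψ (cell θ) θ
  let J : ℕ → Set ℝ := fun i ↦ Set.Icc a b ∩ {θ | |√θ - c i| ≤ 1 / 2}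
  let K : Set (Fin m × Fin d → ℝ) := ⋃ i : Fin m, ψ i '' J i
  let l : ℕ → (Fin m × Fin d → ℝ) →L[ℝ] ℝ := fun j ↦
    ∑ p : Fin m × Fin d, poiSqCoeff j (c p.1) p.2 • ContinuousLinearMap.proj p
  have hlψ (j : ℕ) (i : Fin m) (θ : ℝ) : l j (ψ i θ) =
      ∑ k ∈ Finset.range d, poiSqCoeff j (c i) k * (√θ - c i) ^ k := by
    simp only [l, ψ, FunLike.coe_sum, Finset.sum_apply, FunLike.coe_smul, Pi.smul_apply,
      ContinuousLinearMap.proj_apply, smul_eq_mul, Fintype.sum_prod_type, mul_ite, mul_zero]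
    rw [Finset.sum_eq_single i (by
      intro x _ hx
      simp [Fin.val_inj, hx.symm]) (by simp)]
    simp [Finset.sum_range]
  have happrox (j : ℕ) (i : Fin m) {θ : ℝ} (hθ : θ ∈ J i) :
      |poi j θ - l j (ψ i θ)| ≤ η := by
    rw [hlψ]
    exact (abs_poi_sub_taylor_le j d (ha.le.trans hθ.1.1) hθ.2).trans hd
  have hcell {θ : ℝ} (hθ : θ ∈ Set.Icc a b) : cell θ < m ∧ θ ∈ J (cell θ) := by
    have h0 : 0 ≤ √θ - √a := sub_nonneg.2 (Real.sqrt_le_sqrt hθ.1)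
    have h1 : √θ ≤ √b := Real.sqrt_le_sqrt hθ.2
    refine ⟨Nat.lt_succ_of_le (Nat.floor_le_floor (by linarith)), hθ, ?_⟩
    have h2 := Nat.floor_le h0
    have h3 := Nat.lt_floor_add_one (√θ - √a)
    simp only [Set.mem_ofPred_eq, c, cell]
    rw [abs_le]
    constructor <;> linarith
  have hψ (i : ℕ) : Continuous (ψ i) := by
    refine continuous_pi fun p ↦ ?_
    by_cases h : i = p.1
    · simp only [ψ, h, if_true]
      fun_prop
    · simp only [ψ, h, if_false]
      fun_prop
  have hΦK {θ : ℝ} (hθ : θ ∈ Set.Icc a b) : Φ θ ∈ K :=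
    Set.mem_iUnion.2 ⟨⟨cell θ, (hcell hθ).1⟩, θ, (hcell hθ).2, rfl⟩
  have hKc : IsCompact K := isCompact_iUnion fun i ↦
    (isCompact_Icc.inter_right (isClosed_le (by fun_prop) continuous_const)).image (hψ i)
  have hcell_meas : Measurable cell :=
    Nat.measurable_floor.comp (Real.continuous_sqrt.measurable.sub_const _)
  have hΦm : Measurable Φ := by
    have h : Measurable fun q : ℕ × ℝ ↦ ψ q.1 q.2 :=
      measurable_from_prod_countable_right fun i ↦ (hψ i).measurable
    exact h.comp (hcell_meas.prodMk measurable_id)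
  obtain ⟨B, hB⟩ := hKc.isBounded.exists_norm_le
  have hΦi : Integrable Φ P := Integrable.of_bound hΦm.aestronglyMeasurable B
    (hae.mono fun θ hθ ↦ hB _ (hΦK hθ))
  have hpoi (j : ℕ) : Integrable (poi j) P := by
    have hcont : Continuous (poi j) := by unfold poi; fun_prop
    refine Integrable.of_bound hcont.aestronglyMeasurable 1 (hae.mono fun θ hθ ↦ ?_)
    have h0 := ha.le.trans hθ.1
    rw [Real.norm_of_nonneg (poi_nonneg_s17 j h0)]
    exact poi_le_one j h0
  have hl (j : ℕ) : ‖l j‖ ≤ Fintype.card (Fin m × Fin d) * Real.exp 2 := by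
    refine ContinuousLinearMap.opNorm_le_bound _ (by positivity) fun v ↦ ?_
    simp only [l, FunLike.coe_sum, Finset.sum_apply, FunLike.coe_smul, Pi.smul_apply,
      ContinuousLinearMap.proj_apply, smul_eq_mul]
    refine (norm_sum_le _ _).trans ((Finset.sum_le_card_nsmul _ _ (Real.exp 2 * ‖v‖)
      fun p _ ↦ ?_).trans_eq ?_)
    · rw [norm_mul]
      exact mul_le_mul (abs_poiSqCoeff_le _ _ _) (norm_le_pi_norm v p) (norm_nonneg _)
        (Real.exp_pos _).le
    · rw [nsmul_eq_mul, Finset.card_univ, mul_assoc]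
  obtain ⟨Q, hQ, S, hSI, hQS, hcard, hdiff⟩ := exists_finite_support_approx (I := Set.Icc a b)
    poi l hη hΦi hpoi (hae.mono fun θ hθ ↦ hΦK hθ) hl
    (fun j ↦ hae.mono fun θ hθ ↦ happrox j ⟨cell θ, (hcell hθ).1⟩ (hcell hθ).2) (by
      rintro p hp
      obtain ⟨i, θ, hθ, rfl⟩ := Set.mem_iUnion.1 hp
      exact ⟨θ, hθ.1, fun j ↦ happrox j i hθ⟩)
  refine ⟨Q, hQ, S, hSI, hQS, ?_, hdiff⟩
  simpa using hcard

/-- The number of Taylor terms needed to reach accuracy `ε / 3`. -/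
theorem taylor_degree_bound {ε : ℝ} (hε : 0 < ε) {d : ℕ}
    (hd : 2 * (Real.log (1 / ε) + 4) ≤ d) : 2 * Real.exp 2 * (1 / 2) ^ d ≤ ε / 3 := by
  have hhalf : (1 / 2 : ℝ) ^ d ≤ Real.exp (-(Real.log (1 / ε) + 4)) := by
    have h2 : (1 / 2 : ℝ) = Real.exp (-Real.log 2) := by
      rw [Real.exp_neg, Real.exp_log two_pos, one_div]
    rw [h2, ← Real.exp_nat_mul, Real.exp_le_exp]
    have := Real.log_two_gt_d9
    nlinarith [(Nat.cast_nonneg d : (0 : ℝ) ≤ d)]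
  have hexp : Real.exp (-(Real.log (1 / ε) + 4)) = ε * Real.exp (-2) * Real.exp (-2) := by
    rw [one_div, Real.log_inv, ← Real.exp_log hε, Real.log_exp, ← Real.exp_add, ← Real.exp_add]
    congr 1
    ring
  have hcancel : Real.exp 2 * Real.exp (-2) = 1 := by rw [← Real.exp_add]; simp
  have h6 : 6 ≤ Real.exp 2 := by
    have h := Real.exp_one_gt_d9
    have : Real.exp 2 = Real.exp 1 * Real.exp 1 := by rw [← Real.exp_add]; norm_num
    nlinarith
  calc 2 * Real.exp 2 * (1 / 2) ^ d
      ≤ 2 * Real.exp 2 * (ε * Real.exp (-2) * Real.exp (-2)) := by rw [← hexp]; gcongr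
    _ = 2 * ε * Real.exp (-2) := by linear_combination (2 * ε * Real.exp (-2)) * hcancel
    _ ≤ ε / 3 := by nlinarith [mul_pos hε (Real.exp_pos (-2))]

/-- approximation of Poisson mixtures by finite Poisson mixtures
(Lemma `pois-finite-approx`). -/
theorem stmt17 :
    ∃ C : ℝ, 0 < C ∧
    ∀ ε : ℝ, 0 < ε → ε < 1 / 2 →
    ∀ a b : ℝ, 0 < a → a < b →
    ∀ P : MeasureTheory.Measure ℝ, IsProbOn P (Set.Icc a b) →
    ∃ Q : MeasureTheory.Measure ℝ, MeasureTheory.IsProbabilityMeasure Q ∧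
      ∃ S : Finset ℝ, (S : Set ℝ) ⊆ Set.Icc a b ∧ Q ((S : Set ℝ))ᶜ = 0 ∧
        (S.card : ℝ) ≤ C * ((Real.sqrt b - Real.sqrt a) * Real.log (1 / ε) ^ ((3:ℝ)/2) +
          Real.log (1 / ε) ^ 2) ∧
        ∀ j : ℕ, |pmixT P j - pmixT Q j| ≤ ε := by
  refine ⟨44, by norm_num, fun ε hε hε2 a b ha hab P hP ↦ ?_⟩
  set L := Real.log (1 / ε)
  have hL2 : 1 / 2 < L := by
    have h : Real.log 2 < L := Real.log_lt_log two_pos (by rw [lt_div_iff₀ hε]; linarith)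
    linarith [Real.log_two_gt_d9]
  have hD : 0 ≤ √b - √a := sub_nonneg.2 (Real.sqrt_le_sqrt hab.le)
  obtain ⟨Q, hQ, S, hSI, hQS, hcard, hdiff⟩ := exists_finite_poisson_mixture ha hP
    ⌈2 * (L + 4)⌉₊ (η := ε / 3) (by positivity) (taylor_degree_bound hε (Nat.le_ceil _))
  refine ⟨Q, hQ, S, hSI, hQS, ?_, fun j ↦ (hdiff j).trans_eq (by ring)⟩
  have hd : (⌈2 * (L + 4)⌉₊ : ℝ) ≤ 20 * L := by
    have := Nat.ceil_lt_add_one (show 0 ≤ 2 * (L + 4) by linarith)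
    linarith
  have hpow : L ≤ 2 * L ^ ((3 : ℝ) / 2) := by
    have hL0 : 0 < L := by linarith
    have h1 : L ^ ((3 : ℝ) / 2) = L * √L := by
      rw [Real.sqrt_eq_rpow, show (3 : ℝ) / 2 = 1 + 1 / 2 by norm_num, Real.rpow_add hL0,
        Real.rpow_one]
    have h2 : 1 / 2 ≤ √L := Real.le_sqrt_of_sq_le (by linarith)
    rw [h1]
    nlinarith
  have hcard' : (S.card : ℝ) ≤ (⌊√b - √a⌋₊ + 1) * ⌈2 * (L + 4)⌉₊ + 1 := by exact_mod_cast hcard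
  calc (S.card : ℝ) ≤ (√b - √a + 1) * (20 * L) + 1 := by
        refine hcard'.trans ?_
        gcongr
        exact Nat.floor_le hD
    _ ≤ 44 * ((√b - √a) * L ^ ((3 : ℝ) / 2) + L ^ 2) := by
        nlinarith [mul_le_mul_of_nonneg_left hpow hD]
end

section
/- There exists a universal constant C > 0 such that the following holds. Let t > 0, let P ∈ Δ_{k−1} satisfy the separation assumption with parameter t and centers q_1,…,q_L, set I_ℓ = [q_ℓ − r*_t(q_ℓ), q_ℓ + r*_t(q_ℓ)] with length |I_ℓ| = 2 r*_t(q_ℓ), and let k_ℓ = #{ i ∈ [k] : p_i ∈ I_ℓ }. Then Σ_{ℓ=1}^L |I_ℓ| √(k_ℓ) ≤ C ( t √k + min( √(L t), t^{1/3} ) ) and Σ_{ℓ=1}^L |I_ℓ| k_ℓ ≤ C ( t k + √(t k) ). -/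
open MeasureTheory ProbabilityTheory Set

lemma add_rstar_lt_sub_rstar {t x y : ℝ} (hxy : x ≤ y) (hx : 0 ≤ rstar t x) (hy : 0 ≤ rstar t y)
    (h : fatten (rstar t) {x} ∩ fatten (rstar t) {y} = ∅) :
    x + rstar t x < y - rstar t y := by
  by_contra! hc
  have hm : max (x - rstar t x) (y - rstar t y) ∈
      fatten (rstar t) {x} ∩ fatten (rstar t) {y} := by
    simp only [fatten, Set.mem_singleton_iff, Set.iUnion_iUnion_eq_left, Set.mem_inter_iff,
      Set.mem_Icc]
    refine ⟨⟨le_max_left _ _, max_le ?_ ?_⟩, ⟨le_max_right _ _, max_le ?_ ?_⟩⟩ <;> linarith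
  rw [h] at hm
  exact hm

lemma rstar_nonneg {t : ℝ} (ht : 0 ≤ t) (x : ℝ) : 0 ≤ rstar t x :=
  add_nonneg (Real.sqrt_nonneg _) ht

/-- Separated centers have square roots at distance more than `√t`. -/
lemma sqrt_add_sqrt_lt_sqrt {t x y : ℝ} (ht : 0 < t) (hx : 0 ≤ x) (hxy : x ≤ y)
    (h : fatten (rstar t) {x} ∩ fatten (rstar t) {y} = ∅) : √x + √t < √y := by
  have hlt := add_rstar_lt_sub_rstar hxy (rstar_nonneg ht.le x) (rstar_nonneg ht.le y) h
  simp only [rstar, Real.sqrt_mul ht.le] at hlt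
  have h1 := Real.sq_sqrt hx
  have h2 := Real.sq_sqrt (hx.trans hxy)
  have h3 := Real.sqrt_pos.2 ht
  nlinarith [Real.sqrt_nonneg x, Real.sqrt_nonneg y]

lemma floor_sqrt_div_lt {t x y : ℝ} (ht : 0 < t) (hx : 0 ≤ x) (hxy : x ≤ y)
    (h : fatten (rstar t) {x} ∩ fatten (rstar t) {y} = ∅) :
    ⌊√x / √t⌋₊ < ⌊√y / √t⌋₊ := by
  have h3 := Real.sqrt_pos.2 ht
  have h4 : √x / √t + 1 < √y / √t := by
    rw [div_add_one h3.ne']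
    exact div_lt_div_of_pos_right (sqrt_add_sqrt_lt_sqrt ht hx hxy h) h3
  calc ⌊√x / √t⌋₊ < ⌊√x / √t⌋₊ + 1 := Nat.lt_succ_self _
    _ = ⌊√x / √t + 1⌋₊ := (Nat.floor_add_one (by positivity)).symm
    _ ≤ _ := Nat.floor_mono h4.le

lemma injective_floor_sqrt_div {t : ℝ} {ι : Type*} {q : ι → ℝ} (ht : 0 < t) (hq : ∀ l, 0 ≤ q l)
    (h : ∀ i j, i ≠ j → fatten (rstar t) {q i} ∩ fatten (rstar t) {q j} = ∅) :
    Function.Injective fun l => ⌊√(q l) / √t⌋₊ := by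
  intro i j hij
  by_contra hne
  rcases le_total (q i) (q j) with hle | hle
  · exact (floor_sqrt_div_lt ht (hq i) hle (h i j hne)).ne hij
  · exact (floor_sqrt_div_lt ht (hq j) hle (h j i (Ne.symm hne))).ne hij.symm

/-- At most two separated centers lie in `[0, 4t)`. -/
lemma card_le_two_of_lt {t : ℝ} {ι : Type*} {q : ι → ℝ} (ht : 0 < t) (hq : ∀ l, 0 ≤ q l)
    (h : ∀ i j, i ≠ j → fatten (rstar t) {q i} ∩ fatten (rstar t) {q j} = ∅)
    (S : Finset ι) (hS : ∀ l ∈ S, q l < 4 * t) : S.card ≤ 2 := by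
  have h3 := Real.sqrt_pos.2 ht
  rw [← Finset.card_range 2]
  refine Finset.card_le_card_of_injOn (fun l => ⌊√(q l) / √t⌋₊) (fun l hl => ?_)
    (injective_floor_sqrt_div ht hq h).injOn
  have hlt : √(q l) / √t < (2 : ℕ) := by
    rw [div_lt_iff₀ h3, Real.sqrt_lt' (by positivity), mul_pow, Real.sq_sqrt ht.le]
    push_cast
    linarith [hS l hl]
  simpa using (Nat.floor_lt (by positivity)).2 hlt

/-- Separated centers in `[t, ∞)` with bounded sum number at most of order `t ^ (-1/3)`. -/
lemma mul_card_le_of_sum_le {t u M : ℝ} {ι : Type*} {q : ι → ℝ} (hu : 0 < u) (htu : t = u ^ 3)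
    (hq : ∀ l, 0 ≤ q l)
    (h : ∀ i j, i ≠ j → fatten (rstar t) {q i} ∩ fatten (rstar t) {q j} = ∅)
    (S : Finset ι) (hS : ∀ l ∈ S, t ≤ q l) (hM : ∑ l ∈ S, q l ≤ M) :
    u * S.card ≤ 1 + M := by
  classical
  have ht : 0 < t := by rw [htu]; positivity
  have h3 := Real.sqrt_pos.2 ht
  have hsplit := Finset.card_filter_add_card_filter_not (s := S) (fun l => q l < u)
  have hlow : ((S.filter fun l => q l < u).card : ℝ) ≤ 1 / u := by
    have hc : (S.filter fun l => q l < u).card ≤ (Finset.Icc 1 ⌊1 / u⌋₊).card := by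
      refine Finset.card_le_card_of_injOn (fun l => ⌊√(q l) / √t⌋₊) (fun l hl => ?_)
        (injective_floor_sqrt_div ht hq h).injOn
      obtain ⟨hl, hlu⟩ := Finset.mem_filter.1 (Finset.mem_coe.1 hl)
      refine Finset.mem_coe.2 (Finset.mem_Icc.2 ⟨?_, Nat.floor_mono ?_⟩)
      · rw [Nat.one_le_floor_iff, one_le_div h3]
        exact Real.sqrt_le_sqrt (hS l hl)
      · rw [← Real.sqrt_div (hq l)]
        refine Real.sqrt_le_iff.2 ⟨by positivity, ?_⟩
        rw [htu, div_pow, div_le_div_iff₀ (by positivity) (by positivity)]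
        nlinarith [pow_pos hu 2]
    rw [Nat.card_Icc, Nat.add_sub_cancel] at hc
    exact (Nat.cast_le.2 hc).trans (Nat.floor_le (by positivity))
  have hhigh : ((S.filter fun l => ¬ q l < u).card : ℝ) * u ≤ M := by
    rw [← nsmul_eq_mul]
    calc _ ≤ ∑ l ∈ S.filter (fun l => ¬ q l < u), q l :=
          Finset.card_nsmul_le_sum _ _ _ fun l hl => not_lt.1 (Finset.mem_filter.1 hl).2
      _ ≤ ∑ l ∈ S, q l :=
          Finset.sum_le_sum_of_subset_of_nonneg (Finset.filter_subset _ _) fun l _ _ => hq l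
      _ ≤ M := hM
  rw [le_div_iff₀ hu] at hlow
  have : (S.card : ℝ) = _ := congrArg (Nat.cast (R := ℝ)) hsplit.symm
  rw [this]
  push_cast
  linarith

lemma sum_sum_le_of_pairwise_disjoint {ι κ : Type*} [Fintype κ] {A : ι → Finset κ}
    (hA : ∀ i j, i ≠ j → Disjoint (A i) (A j)) {f : κ → ℝ} (hf : ∀ i, 0 ≤ f i) (S : Finset ι) :
    ∑ l ∈ S, ∑ i ∈ A l, f i ≤ ∑ i, f i := by
  classical
  rw [← Finset.sum_biUnion fun i _ j _ hij => hA i j hij]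
  exact Finset.sum_le_sum_of_subset_of_nonneg (Finset.subset_univ _) fun i _ _ => hf i

lemma rstar_le_of_lt {t x : ℝ} (ht : 0 < t) (hx : x < 4 * t) : rstar t x ≤ 3 * t := by
  have : √(t * x) ≤ 2 * t := Real.sqrt_le_iff.2 ⟨by positivity, by nlinarith⟩
  rw [rstar]
  linarith

lemma rstar_le_of_le {t x : ℝ} (ht : 0 < t) (hx : 4 * t ≤ x) : rstar t x ≤ 2 * (√t * √x) := by
  have : t ≤ √(t * x) := Real.le_sqrt_of_sq_le (by nlinarith)
  rw [rstar, ← Real.sqrt_mul ht.le]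
  linarith

/-- Points within `rstar t x` of a large center `x` are comparable with `x`. -/
lemma le_four_mul_of_sub_rstar_le {t x y : ℝ} (ht : 0 < t) (hx : 4 * t ≤ x)
    (hy : x - rstar t x ≤ y) : x ≤ 4 * y := by
  have : √(t * x) ≤ x / 2 := Real.sqrt_le_iff.2 ⟨by linarith, by nlinarith⟩
  rw [rstar] at hy
  linarith

open Classical in
/-- weighted cluster-size bounds under the separation assumption
(Lemma `pip_sum_weights`). -/
theorem stmt19 :
    ∃ C : ℝ, 0 < C ∧
    ∀ t : ℝ, 0 < t →
    ∀ (k L : ℕ) (p : Fin k → ℝ), (∀ i, 0 ≤ p i) → (∑ i, p i) = 1 →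
    ∀ q : Fin L → ℝ, (∃ s : ℝ, 0 < s ∧ s < t ∧ SepCenters p q s t) →
    ((∑ ℓ, (2 * rstar t (q ℓ)) *
        Real.sqrt ((Finset.univ.filter (fun i =>
          p i ∈ Set.Icc (q ℓ - rstar t (q ℓ)) (q ℓ + rstar t (q ℓ)))).card : ℝ)) ≤
      C * (t * Real.sqrt k + min (Real.sqrt (L * t)) (t ^ ((1:ℝ)/3)))) ∧
    ((∑ ℓ, (2 * rstar t (q ℓ)) *
        ((Finset.univ.filter (fun i =>
          p i ∈ Set.Icc (q ℓ - rstar t (q ℓ)) (q ℓ + rstar t (q ℓ)))).card : ℝ)) ≤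
      C * (t * k + Real.sqrt (t * k))) := by
  refine ⟨24, by norm_num, ?_⟩
  rintro t ht k L p hp hp1 q ⟨s, -, -, -, hq01, hsep, -⟩
  have hq : ∀ l, 0 ≤ q l := fun l => (hq01 l).1
  set A : Fin L → Finset (Fin k) := fun l => Finset.univ.filter fun i =>
    p i ∈ Set.Icc (q l - rstar t (q l)) (q l + rstar t (q l)) with hAdef
  have hA : ∀ i j, i ≠ j → Disjoint (A i) (A j) := by
    intro i j hij
    refine Finset.disjoint_left.2 fun a hai haj => ?_
    have hm : p a ∈ fatten (rstar t) {q i} ∩ fatten (rstar t) {q j} := by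
      simpa [fatten, hAdef] using And.intro hai haj
    rw [hsep i j hij] at hm
    exact hm
  have hcard : ∀ S : Finset (Fin L), ∑ l ∈ S, ((A l).card : ℝ) ≤ k := fun S => by
    simpa using sum_sum_le_of_pairwise_disjoint hA (f := fun _ => 1) (fun _ => zero_le_one) S
  have hAk : ∀ l, ((A l).card : ℝ) ≤ k := fun l => by simpa using hcard {l}
  set low := Finset.univ.filter fun l => q l < 4 * t with hlow
  set high := Finset.univ.filter fun l => ¬ q l < 4 * t with hhigh
  have hlow_mem : ∀ l ∈ low, q l < 4 * t := fun l hl => (Finset.mem_filter.1 hl).2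
  have hhigh_mem : ∀ l ∈ high, 4 * t ≤ q l := fun l hl => not_lt.1 (Finset.mem_filter.1 hl).2
  have hmass : ∑ l ∈ high, q l * (A l).card ≤ 4 := by
    calc ∑ l ∈ high, q l * (A l).card ≤ ∑ l ∈ high, ∑ i ∈ A l, 4 * p i := by
          refine Finset.sum_le_sum fun l hl => ?_
          rw [mul_comm, ← nsmul_eq_mul]
          exact Finset.card_nsmul_le_sum _ _ _ fun i hi =>
            le_four_mul_of_sub_rstar_le ht (hhigh_mem l hl) (Finset.mem_filter.1 hi).2.1
      _ ≤ ∑ i, 4 * p i :=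
          sum_sum_le_of_pairwise_disjoint hA (fun i => mul_nonneg (by norm_num) (hp i)) _
      _ = 4 := by rw [← Finset.mul_sum, hp1, mul_one]
  have hsqrt4 : √(4 : ℝ) = 2 := by
    rw [show (4 : ℝ) = 2 ^ 2 by norm_num, Real.sqrt_sq (by norm_num)]
  constructor
  · rw [← Finset.sum_filter_add_sum_filter_not Finset.univ (fun l => q l < 4 * t)]
    have hL : ∑ l ∈ low, 2 * rstar t (q l) * √((A l).card : ℝ) ≤ 12 * (t * √k) := by
      have h2 : (low.card : ℝ) ≤ 2 := by
        exact_mod_cast card_le_two_of_lt ht hq hsep low hlow_mem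
      calc _ ≤ low.card • (6 * t * √k) := Finset.sum_le_card_nsmul _ _ _ fun l hl => by
            have h1 := rstar_le_of_lt ht (hlow_mem l hl)
            exact mul_le_mul (by linarith) (Real.sqrt_le_sqrt (hAk l)) (Real.sqrt_nonneg _)
              (by positivity)
        _ ≤ 2 * (6 * t * √k) := by
            rw [nsmul_eq_mul]
            exact mul_le_mul_of_nonneg_right h2 (by positivity)
        _ = _ := by ring
    set B := high.filter fun l => (A l).card ≠ 0 with hB
    have hBmass : ∑ l ∈ B, q l * (A l).card ≤ 4 :=
      (Finset.sum_le_sum_of_subset_of_nonneg (Finset.filter_subset _ _)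
        fun l _ _ => mul_nonneg (hq l) (Nat.cast_nonneg _)).trans hmass
    have hH : ∑ l ∈ high, 2 * rstar t (q l) * √((A l).card : ℝ) ≤ 8 * √(B.card * t) := by
      calc _ = ∑ l ∈ B, 2 * rstar t (q l) * √((A l).card : ℝ) := by
            refine (Finset.sum_subset (Finset.filter_subset _ _) fun l hl hlB => ?_).symm
            have hz : (A l).card = 0 := by
              by_contra hz
              exact hlB (Finset.mem_filter.2 ⟨hl, hz⟩)
            rw [hz, Nat.cast_zero, Real.sqrt_zero, mul_zero]
        _ ≤ ∑ l ∈ B, 4 * √t * (√1 * √(q l * (A l).card)) := by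
            refine Finset.sum_le_sum fun l hl => ?_
            have h1 := rstar_le_of_le ht (hhigh_mem l (Finset.mem_filter.1 hl).1)
            rw [Real.sqrt_mul (hq l), Real.sqrt_one]
            nlinarith [mul_le_mul_of_nonneg_right h1 (Real.sqrt_nonneg ((A l).card : ℝ))]
        _ ≤ 4 * √t * (√(∑ l ∈ B, (1 : ℝ)) * √(∑ l ∈ B, q l * (A l).card)) := by
            rw [← Finset.mul_sum]
            refine mul_le_mul_of_nonneg_left ?_ (by positivity)
            exact Real.sum_sqrt_mul_sqrt_le _ (fun _ => zero_le_one)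
              fun l => mul_nonneg (hq l) (Nat.cast_nonneg _)
        _ ≤ 4 * √t * (√B.card * 2) := by
            rw [← hsqrt4]
            simp only [Finset.sum_const, nsmul_eq_mul, mul_one]
            gcongr
        _ = _ := by rw [Real.sqrt_mul (Nat.cast_nonneg _)]; ring
    have hBL : √((B.card : ℝ) * t) ≤ √(L * t) := by
      have : B.card ≤ L := (Finset.card_le_univ B).trans_eq (Fintype.card_fin L)
      gcongr
    have hBt : √((B.card : ℝ) * t) ≤ 3 * t ^ ((1 : ℝ) / 3) := by
      set u := t ^ ((1 : ℝ) / 3) with hu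
      have hu0 : 0 < u := Real.rpow_pos_of_pos ht _
      have htu : t = u ^ 3 := by
        rw [hu, ← Real.rpow_natCast, ← Real.rpow_mul ht.le]
        norm_num
      have hN : u * B.card ≤ 1 + 4 := by
        refine mul_card_le_of_sum_le hu0 htu hq hsep B (fun l hl => ?_)
          ((Finset.sum_le_sum fun l hl => ?_).trans hBmass)
        · linarith [hhigh_mem l (Finset.mem_filter.1 hl).1]
        · refine le_mul_of_one_le_right (hq l) ?_
          exact_mod_cast Nat.one_le_iff_ne_zero.2 (Finset.mem_filter.1 hl).2
      refine Real.sqrt_le_iff.2 ⟨by positivity, ?_⟩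
      calc (B.card : ℝ) * t = u * B.card * u ^ 2 := by rw [htu]; ring
        _ ≤ (1 + 4) * u ^ 2 := by gcongr
        _ ≤ (3 * u) ^ 2 := by nlinarith [sq_nonneg u]
    have hmin : √((B.card : ℝ) * t) ≤ 3 * min √(L * t) (t ^ ((1 : ℝ) / 3)) := by
      rw [mul_min_of_nonneg _ _ (by norm_num)]
      exact le_min (hBL.trans (by linarith [Real.sqrt_nonneg (L * t)])) hBt
    have htk : 0 ≤ t * √(k : ℝ) := by positivity
    linarith
  · rw [← Finset.sum_filter_add_sum_filter_not Finset.univ (fun l => q l < 4 * t)]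
    have hL : ∑ l ∈ low, 2 * rstar t (q l) * ((A l).card : ℝ) ≤ 6 * (t * k) := by
      calc _ ≤ ∑ l ∈ low, 6 * t * ((A l).card : ℝ) := by
            refine Finset.sum_le_sum fun l hl => ?_
            have h1 := rstar_le_of_lt ht (hlow_mem l hl)
            exact mul_le_mul_of_nonneg_right (by linarith) (Nat.cast_nonneg _)
        _ ≤ 6 * t * k := by
            rw [← Finset.mul_sum]
            exact mul_le_mul_of_nonneg_left (hcard low) (by positivity)
        _ = _ := by ring
    have hH : ∑ l ∈ high, 2 * rstar t (q l) * ((A l).card : ℝ) ≤ 8 * √(t * k) := by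
      calc _ ≤ ∑ l ∈ high, 4 * √t * (√(A l).card * √(q l * (A l).card)) := by
            refine Finset.sum_le_sum fun l hl => ?_
            have h1 := rstar_le_of_le ht (hhigh_mem l hl)
            have h2 := Real.mul_self_sqrt (Nat.cast_nonneg (α := ℝ) (A l).card)
            calc 2 * rstar t (q l) * ((A l).card : ℝ)
                ≤ 2 * (2 * (√t * √(q l))) * ((A l).card : ℝ) := by gcongr
              _ = 2 * (2 * (√t * √(q l))) * (√(A l).card * √(A l).card) := by rw [h2]
              _ = _ := by rw [Real.sqrt_mul (hq l)]; ring
        _ ≤ 4 * √t * (√(∑ l ∈ high, ((A l).card : ℝ)) * √(∑ l ∈ high, q l * (A l).card)) := by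
            rw [← Finset.mul_sum]
            refine mul_le_mul_of_nonneg_left ?_ (by positivity)
            exact Real.sum_sqrt_mul_sqrt_le _ (fun _ => Nat.cast_nonneg _)
              fun l => mul_nonneg (hq l) (Nat.cast_nonneg _)
        _ ≤ 4 * √t * (√k * 2) := by
            rw [← hsqrt4]
            have := hcard high
            gcongr
        _ = _ := by rw [Real.sqrt_mul ht.le]; ring
    have htk : 0 ≤ t * (k : ℝ) := by positivity
    linarith [Real.sqrt_nonneg (t * (k : ℝ))]
end
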